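/- arXiv:2109.06863 — 2 statements merged into one kernel-verified Lean document; each statement's English description precedes it below -/
import Mathlib

section
/- Let C₁, C₂ be non-separating continua in the Riemann sphere Ĉ such that C₁ ∩ C₂ = {z} for a single point z ∈ Ĉ. Then the complement Ĉ ∖ (C₁ ∪ C₂) is nonempty, connected, and simply connected (as a topological subspace). -/
open Set

/-- The Riemann sphere, as the one-point compactification of `ℂ`. -/
abbrev RSphere : Type := OnePoint ℂ

/-- A continuum in the Riemann sphere: a nonempty compact connected set. -/
def IsContinuum (C : Set RSphere) : Prop :=
  C.Nonempty ∧ IsCompact C ∧ IsConnected C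

/-- A set is non-separating if its complement in the sphere is nonempty and connected. -/
def NonSeparating (C : Set RSphere) : Prop :=
  Cᶜ.Nonempty ∧ IsConnected Cᶜ

/-- Labels on the edges of the square grid which are prescribed on the good edges extend so as to be
flat around each square in `S`, if no nonempty subset of `S` is enclosed by good edges. -/
theorem exists_flat_extension {G : Type*} [Group G] (gh gv : ℤ × ℤ → Prop) (h v : ℤ × ℤ → G)
    (S : Finset (ℤ × ℤ))
    (hS : ∀ T ⊆ S, T.Nonempty →
      (∃ i j, ¬((i, j) ∈ T ↔ (i + 1, j) ∈ T) ∧ ¬ gv (i + 1, j)) ∨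
      (∃ i j, ¬((i, j) ∈ T ↔ (i, j + 1) ∈ T) ∧ ¬ gh (i, j + 1))) :
    ∃ h' v' : ℤ × ℤ → G, (∀ q, gh q → h' q = h q) ∧ (∀ q, gv q → v' q = v q) ∧
      ∀ i j, (i, j) ∈ S → h' (i, j) * v' (i + 1, j) = v' (i, j) * h' (i, j + 1) := by
  induction S using Finset.strongInduction with
  | H S ih =>
    rcases S.eq_empty_or_nonempty with rfl | hne
    · exact ⟨h, v, by simp⟩
    have step (q : ℤ × ℤ) (hq : q ∈ S) := ih (S.erase q) (Finset.erase_ssubset hq)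
      fun T hT ↦ hS T (hT.trans (Finset.erase_subset _ _))
    rcases hS S subset_rfl hne with ⟨i, j, hij, hg⟩ | ⟨i, j, hij, hg⟩
    · by_cases hm : (i, j) ∈ S
      · have hm' : (i + 1, j) ∉ S := by tauto
        obtain ⟨h', v', hh, hv, hf⟩ := step _ hm
        refine ⟨h', Function.update v' (i + 1, j) ((h' (i, j))⁻¹ * v' (i, j) * h' (i, j + 1)),
          hh, fun q hq ↦ ?_, fun a b hab ↦ ?_⟩
        · rw [Function.update_of_ne (by rintro rfl; exact hg hq), hv q hq]
        · by_cases he : (a, b) = (i, j)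
          · obtain ⟨rfl, rfl⟩ := Prod.mk.inj he
            simp [Function.update, mul_assoc]
          · rw [Function.update_of_ne (by simpa using he),
              Function.update_of_ne (by rintro h; exact hm' (h ▸ hab))]
            exact hf a b (Finset.mem_erase.2 ⟨he, hab⟩)
      · have hm' : (i + 1, j) ∈ S := by tauto
        obtain ⟨h', v', hh, hv, hf⟩ := step _ hm'
        refine ⟨h', Function.update v' (i + 1, j)
          (h' (i + 1, j) * v' (i + 1 + 1, j) * (h' (i + 1, j + 1))⁻¹),
          hh, fun q hq ↦ ?_, fun a b hab ↦ ?_⟩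
        · rw [Function.update_of_ne (by rintro rfl; exact hg hq), hv q hq]
        · by_cases he : (a, b) = (i + 1, j)
          · obtain ⟨rfl, rfl⟩ := Prod.mk.inj he
            simp [Function.update, mul_assoc]
          · rw [Function.update_of_ne (a := (a, b)) (by simpa using he),
              Function.update_of_ne]
            · exact hf a b (Finset.mem_erase.2 ⟨he, hab⟩)
            · intro h
              simp only [Prod.mk.injEq, add_left_inj] at h
              exact hm (h.1 ▸ h.2 ▸ hab)
    · by_cases hm : (i, j) ∈ S
      · have hm' : (i, j + 1) ∉ S := by tauto
        obtain ⟨h', v', hh, hv, hf⟩ := step _ hm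
        refine ⟨Function.update h' (i, j + 1) ((v' (i, j))⁻¹ * h' (i, j) * v' (i + 1, j)), v',
          fun q hq ↦ ?_, hv, fun a b hab ↦ ?_⟩
        · rw [Function.update_of_ne (by rintro rfl; exact hg hq), hh q hq]
        · by_cases he : (a, b) = (i, j)
          · obtain ⟨rfl, rfl⟩ := Prod.mk.inj he
            simp [Function.update, mul_assoc]
          · rw [Function.update_of_ne (a := (a, b)) (by rintro h; exact hm' (h ▸ hab)),
              Function.update_of_ne (by simpa using he)]
            exact hf a b (Finset.mem_erase.2 ⟨he, hab⟩)
      · have hm' : (i, j + 1) ∈ S := by tauto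
        obtain ⟨h', v', hh, hv, hf⟩ := step _ hm'
        refine ⟨Function.update h' (i, j + 1)
          (v' (i, j + 1) * h' (i, j + 1 + 1) * (v' (i + 1, j + 1))⁻¹), v',
          fun q hq ↦ ?_, hv, fun a b hab ↦ ?_⟩
        · rw [Function.update_of_ne (by rintro rfl; exact hg hq), hh q hq]
        · by_cases he : (a, b) = (i, j + 1)
          · obtain ⟨rfl, rfl⟩ := Prod.mk.inj he
            simp [Function.update, mul_assoc]
          · rw [Function.update_of_ne (a := (a, b)) (by simpa using he),
              Function.update_of_ne]
            · exact hf a b (Finset.mem_erase.2 ⟨he, hab⟩)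
            · intro h
              simp only [Prod.mk.injEq, add_left_inj] at h
              exact hm (h.1 ▸ h.2 ▸ hab)

/-- A flat labelling of the edges of a quadrant grid has a potential. -/
theorem exists_potential_nat {G : Type*} [Group G] (h v : ℕ → ℕ → G) (N : ℕ)
    (hf : ∀ i j, i < N → j < N → h i j * v (i + 1) j = v i j * h i (j + 1)) :
    ∃ Φ : ℕ → ℕ → G, (∀ i j, i < N → j ≤ N → Φ i j * h i j = Φ (i + 1) j) ∧
      ∀ i j, Φ i j * v i j = Φ i (j + 1) := by
  let Φ : ℕ → ℕ → G := fun i j ↦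
    ((List.range i).map (h · 0)).prod * ((List.range j).map (v i)).prod
  have hΦ : ∀ i j, Φ i j * v i j = Φ i (j + 1) := fun i j ↦ by
    simp [Φ, List.range_succ, mul_assoc]
  refine ⟨Φ, fun i j hi ↦ ?_, hΦ⟩
  induction j with
  | zero => simp [Φ, List.range_succ]
  | succ j ihj =>
    intro hj
    rw [← hΦ, ← hΦ, mul_assoc, ← hf i j hi hj, ← mul_assoc, ihj (Nat.le_of_succ_le hj)]

/-- A flat labelling of the edges of a square grid centered at the origin has a potential. -/
theorem exists_potential_int {G : Type*} [Group G] (h v : ℤ × ℤ → G) (N : ℕ)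
    (hf : ∀ i j : ℤ, -N ≤ i → i < N → -N ≤ j → j < N →
      h (i, j) * v (i + 1, j) = v (i, j) * h (i, j + 1)) :
    ∃ Φ : ℤ × ℤ → G,
      (∀ i j : ℤ, -N ≤ i → i < N → -N ≤ j → j ≤ N → Φ (i, j) * h (i, j) = Φ (i + 1, j)) ∧
      ∀ i j : ℤ, -N ≤ i → -N ≤ j → Φ (i, j) * v (i, j) = Φ (i, j + 1) := by
  obtain ⟨Ψ, hΨ₁, hΨ₂⟩ := exists_potential_nat (fun a b ↦ h (a - N, b - N))
    (fun a b ↦ v (a - N, b - N)) (2 * N) (fun i j hi hj ↦ by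
      convert! hf (i - N) (j - N) (by lia) (by lia) (by lia) (by lia) using 4 <;> grind)
  refine ⟨fun q ↦ Ψ (q.1 + N).toNat (q.2 + N).toNat, fun i j hi hi' hj hj' ↦ ?_,
    fun i j hi hj ↦ ?_⟩
  · obtain ⟨a, ha⟩ := Int.eq_ofNat_of_zero_le (show 0 ≤ i + N by lia)
    obtain ⟨b, hb⟩ := Int.eq_ofNat_of_zero_le (show 0 ≤ j + N by lia)
    obtain rfl : i = a - N := by lia
    obtain rfl : j = b - N := by lia
    have h₁ : (a - N + 1 + N : ℤ).toNat = a + 1 := by lia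
    simpa [h₁] using hΨ₁ a b (by lia) (by lia)
  · obtain ⟨a, ha⟩ := Int.eq_ofNat_of_zero_le (show 0 ≤ i + N by lia)
    obtain ⟨b, hb⟩ := Int.eq_ofNat_of_zero_le (show 0 ≤ j + N by lia)
    obtain rfl : i = a - N := by lia
    obtain rfl : j = b - N := by lia
    have h₁ : (b - N + 1 + N : ℤ).toNat = b + 1 := by lia
    simpa [h₁] using hΨ₂ a b

/-- A separated union of two closed sets with connected complement does not separate the plane. -/
theorem isPreconnected_compl_union {F₁ F₂ : Set ℂ} (h₁ : IsClosed F₁) (h₂ : IsClosed F₂)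
    (hd : Disjoint F₁ F₂) (hc₁ : IsPreconnected F₁ᶜ) (hc₂ : IsPreconnected F₂ᶜ) :
    IsPreconnected (F₁ ∪ F₂)ᶜ := by
  classical
  rw [isPreconnected_iff_subset_of_disjoint (s := (F₁ ∪ F₂)ᶜ)]
  intro V W hV hW hVW hdVW
  by_contra! hcon
  simp only [not_subset] at hcon
  obtain ⟨⟨y, hyU, hyV⟩, x, hxU, hxW⟩ := hcon
  set U := (F₁ ∪ F₂)ᶜ with hU
  have hUo : IsOpen U := (h₁.union h₂).isOpen_compl
  have hxV : x ∈ V := (hVW hxU).resolve_right hxW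
  have hfr : ∀ a ∈ frontier (V ∩ U), a ∈ F₁ ∪ F₂ := by
    intro a ha
    by_contra haU
    rcases hVW haU with haV | haW
    · exact ((hV.inter hUo).frontier_eq ▸ ha).2 ⟨haV, haU⟩
    · obtain ⟨b, hb, hb'⟩ := mem_closure_iff.1 (frontier_subset_closure ha) (W ∩ U)
        (hW.inter hUo) ⟨haW, haU⟩
      exact (hdVW ▸ (⟨hb'.2, hb'.1, hb.1⟩ : b ∈ U ∩ (V ∩ W)) : b ∈ (∅ : Set ℂ))
  obtain ⟨χ, hχ₁, hχ₂, -⟩ := exists_continuous_zero_one_of_isClosed h₁ h₂ hd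
  set e : ℂ → ℂ := fun a ↦ 2 * Real.pi * Complex.I * χ a with he
  have hec : Continuous e := by fun_prop
  have he₁ : ∀ a ∈ F₁, e a = 0 := fun a ha ↦ by simp [he, hχ₁ ha]
  have he₂ : ∀ a ∈ F₂, e a = 2 * Real.pi * Complex.I := fun a ha ↦ by simp [he, hχ₂ ha]
  let g : ℂ → ℂ := fun a ↦ if a ∈ V ∩ U then Complex.exp (e a) else 1
  have hgc : Continuous g := by
    refine Continuous.if ?_ (by fun_prop) (by fun_prop)
    intro a ha
    rcases hfr a ha with ha | ha
    · simp [he₁ a ha]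
    · simp [he₂ a ha]
  have hsc : IsSimplyConnected (univ : Set ℂ) :=
    (Homeomorph.Set.univ ℂ).toHomotopyEquiv.simplyConnectedSpace_iff.2 inferInstance
  obtain ⟨h, hhc, hh⟩ := Complex.exists_continuousOn_eqOn_exp_comp hsc isOpen_univ
    hgc.continuousOn (by
      rintro ⟨a, -, ha⟩
      by_cases haV : a ∈ V ∩ U <;> simp [g, haV, -mem_inter_iff] at ha)
  rw [continuousOn_univ] at hhc
  have hh' : ∀ a, Complex.exp (h a) = g a := fun a ↦ hh (mem_univ a)
  have key (F : Set ℂ) (hF : IsPreconnected Fᶜ) (c : ℂ) (hc : Complex.exp c = 1)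
      (hFc : ∀ a ∈ F₁ ∪ F₂, a ∉ F → e a = c) (hxF : x ∉ F) (hyF : y ∉ F) :
      h x - (e x - c) = h y := by
    let k : ℂ → ℂ := fun a ↦ if a ∈ V ∩ U then h a - (e a - c) else h a
    have hk : ContinuousOn k Fᶜ := by
      refine ContinuousOn.if ?_ (by fun_prop) (by fun_prop)
      rintro a ⟨haF, ha⟩
      simp [hFc a (hfr a ha) haF]
    have hk1 : ∀ a, Complex.exp (k a) = 1 := by
      intro a
      by_cases ha : a ∈ V ∩ U
      · simp [k, ha, -mem_inter_iff, Complex.exp_sub, hh', g, hc, Complex.exp_ne_zero]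
      · simp [k, ha, -mem_inter_iff, hh', g]
    have := Complex.isCoveringMap_exp.constOn_of_comp hF hk
      (fun a _ b _ ↦ by simp [hk1]) hxF hyF
    have hy : y ∉ V ∩ U := fun hy ↦ hyV hy.1
    simpa only [k, if_pos (show x ∈ V ∩ U from ⟨hxV, hxU⟩), if_neg hy] using this
  have e₁ := key F₁ hc₁ (2 * Real.pi * Complex.I) Complex.exp_two_pi_mul_I
    (fun a ha haF ↦ he₂ a (ha.resolve_left haF)) (fun h ↦ hxU (.inl h)) (fun h ↦ hyU (.inl h))
  have e₂ := key F₂ hc₂ 0 Complex.exp_zero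
    (fun a ha haF ↦ he₁ a (ha.resolve_right haF)) (fun h ↦ hxU (.inr h)) (fun h ↦ hyU (.inr h))
  have : (2 * Real.pi * Complex.I : ℂ) = 0 := by linear_combination e₁ - e₂
  simp [Real.pi_ne_zero] at this

/-- The vertices of the square grid of mesh `δ`. -/
def gridVertex (δ : ℝ) (q : ℤ × ℤ) : ℂ := ⟨δ * q.1, δ * q.2⟩

/-- The closed squares of the grid of mesh `δ`, indexed by their lower left vertices. -/
def gridSquare (δ : ℝ) (q : ℤ × ℤ) : Set ℂ :=
  Icc (δ * q.1) (δ * (q.1 + 1)) ×ℂ Icc (δ * q.2) (δ * (q.2 + 1))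

theorem isCompact_gridSquare (δ : ℝ) (q : ℤ × ℤ) : IsCompact (gridSquare δ q) :=
  isCompact_Icc.reProdIm isCompact_Icc

theorem convex_gridSquare (δ : ℝ) (q : ℤ × ℤ) : Convex ℝ (gridSquare δ q) :=
  ((convex_Icc _ _).linear_preimage Complex.reLm).inter
    ((convex_Icc _ _).linear_preimage Complex.imLm)

theorem mem_segment_vertical {δ : ℝ} (hδ : 0 < δ) {i j : ℤ} {a : ℂ} (hre : a.re = δ * i)
    (h₁ : δ * j ≤ a.im) (h₂ : a.im ≤ δ * (j + 1)) :
    a ∈ segment ℝ (gridVertex δ (i, j)) (gridVertex δ (i, j + 1)) := by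
  rw [segment_eq_image]
  refine ⟨(a.im - δ * j) / δ, ⟨div_nonneg (by linarith) hδ.le, ?_⟩, ?_⟩
  · rw [div_le_one hδ]; linarith
  · apply Complex.ext <;> simp [gridVertex, hre] <;> field_simp <;> ring

theorem mem_segment_horizontal {δ : ℝ} (hδ : 0 < δ) {i j : ℤ} {a : ℂ} (him : a.im = δ * j)
    (h₁ : δ * i ≤ a.re) (h₂ : a.re ≤ δ * (i + 1)) :
    a ∈ segment ℝ (gridVertex δ (i, j)) (gridVertex δ (i + 1, j)) := by
  rw [segment_eq_image]
  refine ⟨(a.re - δ * i) / δ, ⟨div_nonneg (by linarith) hδ.le, ?_⟩, ?_⟩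
  · rw [div_le_one hδ]; linarith
  · apply Complex.ext <;> simp [gridVertex, him] <;> field_simp <;> ring

/-- If the edges of the grid separating the squares in `T` from the others lie in `U`, then all
squares through a point outside `U` are simultaneously in `T` or not in `T`. -/
theorem mem_of_mem_gridSquare {U : Set ℂ} {δ : ℝ} (hδ : 0 < δ) {T : Set (ℤ × ℤ)}
    (hv : ∀ i j, ¬((i, j) ∈ T ↔ (i + 1, j) ∈ T) →
      segment ℝ (gridVertex δ (i + 1, j)) (gridVertex δ (i + 1, j + 1)) ⊆ U)
    (hh : ∀ i j, ¬((i, j) ∈ T ↔ (i, j + 1) ∈ T) →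
      segment ℝ (gridVertex δ (i, j + 1)) (gridVertex δ (i + 1, j + 1)) ⊆ U)
    {a : ℂ} (ha : a ∉ U) {q q' : ℤ × ℤ} (hq : a ∈ gridSquare δ q) (hq' : a ∈ gridSquare δ q')
    (hqT : q ∈ T) : q' ∈ T := by
  have hv' (i j) (h : a ∈ gridSquare δ (i, j)) (h' : a ∈ gridSquare δ (i + 1, j)) :
      (i, j) ∈ T ↔ (i + 1, j) ∈ T := by
    by_contra hcon
    simp only [gridSquare, Complex.mem_reProdIm, mem_Icc] at h h'
    push_cast at h h'
    refine ha (hv i j hcon (mem_segment_vertical hδ ?_ h.2.1 h.2.2))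
    push_cast
    linarith [h.1.2, h'.1.1]
  have hh' (i j) (h : a ∈ gridSquare δ (i, j)) (h' : a ∈ gridSquare δ (i, j + 1)) :
      (i, j) ∈ T ↔ (i, j + 1) ∈ T := by
    by_contra hcon
    simp only [gridSquare, Complex.mem_reProdIm, mem_Icc] at h h'
    push_cast at h h'
    refine ha (hh i j hcon (mem_segment_horizontal hδ ?_ h.1.1 h.1.2))
    push_cast
    linarith [h.2.2, h'.2.1]
  have hnear {x : ℝ} {m n : ℤ} (h₁ : δ * m ≤ x) (h₂ : x ≤ δ * (m + 1)) (h₃ : δ * n ≤ x)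
      (h₄ : x ≤ δ * (n + 1)) : m ≤ n + 1 := by
    have : δ * (m : ℝ) ≤ δ * ((n + 1 : ℤ) : ℝ) := by push_cast; linarith
    exact_mod_cast le_of_mul_le_mul_left this hδ
  obtain ⟨i, j⟩ := q
  obtain ⟨i', j'⟩ := q'
  have hmid : a ∈ gridSquare δ (i', j) := ⟨hq'.1, hq.2⟩
  have hmT : (i', j) ∈ T := by
    have h₁ := hnear hq.1.1 hq.1.2 hq'.1.1 hq'.1.2
    have h₂ := hnear hq'.1.1 hq'.1.2 hq.1.1 hq.1.2
    obtain rfl | rfl | rfl : i' = i ∨ i' = i + 1 ∨ i = i' + 1 := by lia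
    · exact hqT
    · exact (hv' _ _ hq hmid).1 hqT
    · exact (hv' _ _ hmid hq).2 hqT
  have h₁ := hnear hq.2.1 hq.2.2 hq'.2.1 hq'.2.2
  have h₂ := hnear hq'.2.1 hq'.2.2 hq.2.1 hq.2.2
  obtain rfl | rfl | rfl : j' = j ∨ j' = j + 1 ∨ j = j' + 1 := by lia
  · exact hmT
  · exact (hh' _ _ hmid hq').1 hmT
  · exact (hh' _ _ hq' hmid).2 hmT

/-- Near any point, the points of the plane share a grid square with it. -/
theorem eventually_exists_gridSquare {δ : ℝ} (hδ : 0 < δ) (a : ℂ) :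
    ∀ᶠ y in nhds a, ∃ q, a ∈ gridSquare δ q ∧ y ∈ gridSquare δ q := by
  have hr (x : ℝ) : ∀ᶠ t in nhds x, ∃ m : ℤ, x ∈ Icc (δ * m) (δ * (m + 1)) ∧
      t ∈ Icc (δ * m) (δ * (m + 1)) := by
    have hmul (u : ℝ) (m : ℤ) : u ∈ Icc (δ * m) (δ * (m + 1)) ↔ ↑m ≤ u / δ ∧ u / δ ≤ m + 1 := by
      rw [le_div_iff₀' hδ, div_le_iff₀' hδ, mem_Icc]
    have hc : Filter.Tendsto (fun t : ℝ ↦ t / δ) (nhds x) (nhds (x / δ)) :=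
      (continuous_id.div_const δ).tendsto x
    have h₁ : (⌈x / δ⌉ - 1 : ℝ) < x / δ := by linarith [Int.ceil_lt_add_one (x / δ)]
    filter_upwards [hc.eventually (lt_mem_nhds h₁),
      hc.eventually (gt_mem_nhds (Int.lt_floor_add_one (x / δ)))] with t ht₁ ht₂
    refine ⟨⌊t / δ⌋, (hmul _ _).2 ⟨?_, ?_⟩, (hmul _ _).2
      ⟨Int.floor_le _, (Int.lt_floor_add_one _).le⟩⟩
    · refine le_trans ?_ (Int.floor_le (x / δ))
      have : ⌊t / δ⌋ < ⌊x / δ⌋ + 1 := Int.floor_lt.2 (by exact_mod_cast ht₂)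
      exact_mod_cast Int.lt_add_one_iff.1 this
    · refine (Int.le_ceil (x / δ)).trans ?_
      have : ⌈x / δ⌉ - 1 ≤ ⌊t / δ⌋ := Int.le_floor.2 (by push_cast; exact ht₁.le)
      exact_mod_cast (by lia : ⌈x / δ⌉ ≤ ⌊t / δ⌋ + 1)
  filter_upwards [Complex.continuous_re.continuousAt.eventually (hr a.re),
    Complex.continuous_im.continuousAt.eventually (hr a.im)] with y ⟨m, hm⟩ ⟨n, hn⟩
  exact ⟨(m, n), ⟨hm.1, hn.1⟩, hm.2, hn.2⟩

/-- A nonempty finite set of grid squares meeting the complement of `U` is not cut off from the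
rest by edges in `U`, if this complement has no nonempty compact relatively open subset. -/
theorem exists_crossing {U : Set ℂ} (hU : IsOpen U)
    (hF : ∀ A ⊆ Uᶜ, IsCompact A → IsClosed (Uᶜ \ A) → A = ∅) {δ : ℝ} (hδ : 0 < δ)
    (T : Finset (ℤ × ℤ)) (hT : T.Nonempty) (hTU : ∀ q ∈ T, ¬ gridSquare δ q ⊆ U) :
    (∃ i j, ¬((i, j) ∈ T ↔ (i + 1, j) ∈ T) ∧
      ¬ segment ℝ (gridVertex δ (i + 1, j)) (gridVertex δ (i + 1, j + 1)) ⊆ U) ∨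
    (∃ i j, ¬((i, j) ∈ T ↔ (i, j + 1) ∈ T) ∧
      ¬ segment ℝ (gridVertex δ (i, j + 1)) (gridVertex δ (i + 1, j + 1)) ⊆ U) := by
  by_contra hcon
  have hmem {a} (ha : a ∉ U) {q q'} := mem_of_mem_gridSquare (T := (T : Set (ℤ × ℤ))) hδ
    (fun i j h ↦ by_contra fun hn ↦ hcon (.inl ⟨i, j, by simpa using! h, hn⟩))
    (fun i j h ↦ by_contra fun hn ↦ hcon (.inr ⟨i, j, by simpa using! h, hn⟩)) ha
    (q := q) (q' := q')
  set A := Uᶜ ∩ ⋃ q ∈ T, gridSquare δ q with hA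
  have hAc : IsCompact A :=
    (T.isCompact_biUnion fun q _ ↦ isCompact_gridSquare δ q).inter_left hU.isClosed_compl
  have hAcl : IsClosed (Uᶜ \ A) := by
    rw [← isOpen_compl_iff, isOpen_iff_mem_nhds]
    intro a ha
    by_cases haU : a ∈ U
    · exact Filter.mem_of_superset (hU.mem_nhds haU) fun y hy hy' ↦ hy'.1 hy
    · have haA : a ∈ A := by by_contra h; exact ha ⟨haU, h⟩
      obtain ⟨-, haT⟩ := haA
      simp only [mem_iUnion, exists_prop] at haT
      obtain ⟨q, hqT, hq⟩ := haT
      filter_upwards [eventually_exists_gridSquare hδ a] with y ⟨q', haq', hyq'⟩ hy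
      exact hy.2 ⟨hy.1, mem_biUnion (hmem haU hq haq' hqT) hyq'⟩
  obtain ⟨q, hq⟩ := hT
  obtain ⟨a, haq, haU⟩ := not_subset.1 (hTU q hq)
  have : a ∈ A := ⟨haU, mem_biUnion hq haq⟩
  exact (hF A inter_subset_left hAc hAcl ▸ this : a ∈ (∅ : Set ℂ))

theorem gridVertex_mem_gridSquare {δ : ℝ} (hδ : 0 < δ) (i j : ℤ) :
    gridVertex δ (i, j) ∈ gridSquare δ (i, j) ∧ gridVertex δ (i + 1, j) ∈ gridSquare δ (i, j) ∧
      gridVertex δ (i, j + 1) ∈ gridSquare δ (i, j) ∧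
      gridVertex δ (i + 1, j + 1) ∈ gridSquare δ (i, j) := by
  simp only [gridVertex, gridSquare, Complex.mem_reProdIm, mem_Icc]
  push_cast
  refine ⟨⟨⟨?_, ?_⟩, ?_, ?_⟩, ⟨⟨?_, ?_⟩, ?_, ?_⟩, ⟨⟨?_, ?_⟩, ?_, ?_⟩, ⟨?_, ?_⟩, ?_, ?_⟩ <;>
    linarith

/-- A group-valued cocycle `g` on the convex subsets of a plane open set whose complement has no
nonempty compact relatively open subset is, near any compact set, the coboundary of a potential. -/
theorem exists_potential {G : Type*} [Group G] {U : Set ℂ} (hU : IsOpen U)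
    (hF : ∀ A ⊆ Uᶜ, IsCompact A → IsClosed (Uᶜ \ A) → A = ∅) (g : ℂ → ℂ → G)
    (hg : ∀ B ⊆ U, Convex ℝ B → ∀ x ∈ B, ∀ y ∈ B, ∀ z ∈ B, g x y * g y z = g x z)
    {K : Set ℂ} (hK : IsCompact K) (hKU : K ⊆ U) :
    ∃ φ : ℂ → G, ∃ η > 0, ∀ x ∈ K, ∀ y ∈ K, dist x y < η → φ x * g x y = φ y := by
  obtain ⟨ε, hε, hεU⟩ := hK.exists_thickening_subset_open hU hKU
  have hball {x} (hx : x ∈ K) : Metric.ball x ε ⊆ U :=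
    (Metric.ball_subset_thickening hx ε).trans hεU
  obtain ⟨δ, hδ, hδε⟩ : ∃ δ : ℝ, 0 < δ ∧ 10 * δ = ε := ⟨ε / 10, by positivity, by ring⟩
  obtain ⟨R, hR⟩ := hK.isBounded.exists_norm_le
  obtain ⟨N, hN⟩ := exists_nat_gt (R / δ + 3)
  set w := gridVertex δ with hw
  classical
  set S := {q ∈ Finset.Ico (-N : ℤ) N ×ˢ Finset.Ico (-N : ℤ) N | ¬ gridSquare δ q ⊆ U} with hS
  obtain ⟨h, v, hh, hv, hf⟩ := exists_flat_extension
    (fun q ↦ segment ℝ (w q) (w (q.1 + 1, q.2)) ⊆ U)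
    (fun q ↦ segment ℝ (w q) (w (q.1, q.2 + 1)) ⊆ U)
    (fun q ↦ g (w q) (w (q.1 + 1, q.2))) (fun q ↦ g (w q) (w (q.1, q.2 + 1))) S
    fun T hTS hT ↦ exists_crossing hU hF hδ T hT fun q hq ↦ (Finset.mem_filter.1 (hTS hq)).2
  obtain ⟨Φ, hΦ₁, hΦ₂⟩ := exists_potential_int h v N fun i j h₁ h₂ h₃ h₄ ↦ by
    by_cases hs : gridSquare δ (i, j) ⊆ U
    · obtain ⟨m₁, m₂, m₃, m₄⟩ := gridVertex_mem_gridSquare hδ i j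
      have hc := convex_gridSquare δ (i, j)
      rw [hh _ ((hc.segment_subset m₁ m₂).trans hs), hh _ ((hc.segment_subset m₃ m₄).trans hs),
        hv _ ((hc.segment_subset m₁ m₃).trans hs), hv _ ((hc.segment_subset m₂ m₄).trans hs)]
      exact (hg _ hs hc _ m₁ _ m₂ _ m₄).trans (hg _ hs hc _ m₁ _ m₃ _ m₄).symm
    · exact hf i j (by simp [hS, hs, h₁, h₂, h₃, h₄])
  have hstep {B : Set ℂ} (hB : B ⊆ U) (hBc : Convex ℝ B) {i j i' j' : ℤ} (hi : |i - i'| ≤ 1)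
      (hj : |j - j'| ≤ 1) (h₁ : -N ≤ i) (h₂ : i < N) (h₃ : -N ≤ j) (h₄ : j < N) (h₁' : -N ≤ i')
      (h₂' : i' < N) (h₃' : -N ≤ j') (hw₁ : w (i, j) ∈ B) (hw₂ : w (i', j) ∈ B)
      (hw₃ : w (i', j') ∈ B) : Φ (i, j) * g (w (i, j)) (w (i', j')) = Φ (i', j') := by
    have hself {x} (hx : x ∈ B) : g x x = 1 := by simpa using hg B hB hBc x hx x hx x hx
    have hhor {i : ℤ} (h₁ : -N ≤ i) (h₂ : i < N) (hw₁ : w (i, j) ∈ B) (hw₂ : w (i + 1, j) ∈ B) :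
        Φ (i, j) * g (w (i, j)) (w (i + 1, j)) = Φ (i + 1, j) := by
      rw [← hΦ₁ i j h₁ h₂ h₃ h₄.le, hh _ ((hBc.segment_subset hw₁ hw₂).trans hB)]
    have hver {j : ℤ} (h₃ : -N ≤ j) (hw₁ : w (i', j) ∈ B) (hw₂ : w (i', j + 1) ∈ B) :
        Φ (i', j) * g (w (i', j)) (w (i', j + 1)) = Φ (i', j + 1) := by
      rw [← hΦ₂ i' j h₁' h₃, hv _ ((hBc.segment_subset hw₁ hw₂).trans hB)]
    rw [← hg B hB hBc _ hw₁ _ hw₂ _ hw₃, ← mul_assoc]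
    rw [abs_le] at hi hj
    have hmid : Φ (i, j) * g (w (i, j)) (w (i', j)) = Φ (i', j) := by
      obtain rfl | rfl | rfl : i' = i ∨ i' = i + 1 ∨ i = i' + 1 := by lia
      · rw [hself hw₁, mul_one]
      · exact hhor h₁ h₂ hw₁ hw₂
      · rw [← hhor h₁' h₂' hw₂ hw₁, mul_assoc, hg B hB hBc _ hw₂ _ hw₁ _ hw₂, hself hw₂, mul_one]
    rw [hmid]
    obtain rfl | rfl | rfl : j' = j ∨ j' = j + 1 ∨ j = j' + 1 := by lia
    · rw [hself hw₂, mul_one]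
    · exact hver h₃ hw₂ hw₃
    · rw [← hver h₃' hw₃ hw₂, mul_assoc, hg B hB hBc _ hw₃ _ hw₂ _ hw₃, hself hw₃, mul_one]
  have hfloor {t : ℝ} (ht : |t| ≤ R) : (-N : ℤ) ≤ ⌊t / δ⌋ ∧ ⌊t / δ⌋ < N := by
    rw [abs_le] at ht
    have h₁ : -(R / δ) ≤ t / δ := by rw [← neg_div]; gcongr; exact ht.1
    have h₂ : t / δ ≤ R / δ := by gcongr; exact ht.2
    refine ⟨Int.le_floor.2 ?_, Int.floor_lt.2 ?_⟩ <;> push_cast <;> linarith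
  have hclose {s t : ℝ} (hst : |s - t| < δ) : |⌊s / δ⌋ - ⌊t / δ⌋| ≤ 1 := by
    have h₁ : |s / δ - t / δ| < 1 := by
      rw [← sub_div, abs_div, abs_of_pos hδ, div_lt_one hδ]; exact hst
    rw [abs_lt] at h₁
    have h₂ : ⌊s / δ⌋ < ⌊t / δ⌋ + 2 := by
      rw [Int.floor_lt]; push_cast; linarith [Int.lt_floor_add_one (t / δ)]
    have h₃ : ⌊t / δ⌋ < ⌊s / δ⌋ + 2 := by
      rw [Int.floor_lt]; push_cast; linarith [Int.lt_floor_add_one (s / δ)]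
    rw [abs_le]; lia
  have hdist (t : ℝ) : |δ * ⌊t / δ⌋ - t| ≤ δ := by
    have h₁ : δ * ⌊t / δ⌋ ≤ t := by
      rw [← le_div_iff₀' hδ]; exact Int.floor_le _
    have h₂ : t ≤ δ * (⌊t / δ⌋ + 1) := by
      rw [← div_le_iff₀' hδ]; exact (Int.lt_floor_add_one _).le
    rw [abs_le]; constructor <;> linarith
  refine ⟨fun x ↦ Φ (⌊x.re / δ⌋, ⌊x.im / δ⌋) * g (w (⌊x.re / δ⌋, ⌊x.im / δ⌋)) x, δ, hδ,
    fun x hx y hy hxy ↦ ?_⟩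
  have hre : |x.re - y.re| < δ := by
    simpa using (Complex.abs_re_le_norm (x - y)).trans_lt (by rwa [← dist_eq_norm])
  have him : |x.im - y.im| < δ := by
    simpa using (Complex.abs_im_le_norm (x - y)).trans_lt (by rwa [← dist_eq_norm])
  have hmem {i j : ℤ} (h₁ : |δ * i - x.re| ≤ 2 * δ) (h₂ : |δ * j - x.im| ≤ 2 * δ) :
      w (i, j) ∈ Metric.ball x ε := by
    rw [Metric.mem_ball, dist_eq_norm]
    have := Complex.norm_le_abs_re_add_abs_im (w (i, j) - x)
    simp only [hw, gridVertex, Complex.sub_re, Complex.sub_im] at this ⊢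
    linarith
  have hxr := hdist x.re
  have hxi := hdist x.im
  have hyr : |δ * ⌊y.re / δ⌋ - x.re| ≤ 2 * δ := by
    have := abs_sub_le (δ * ⌊y.re / δ⌋) y.re x.re
    rw [abs_sub_comm y.re] at this
    linarith [hdist y.re]
  have hyi : |δ * ⌊y.im / δ⌋ - x.im| ≤ 2 * δ := by
    have := abs_sub_le (δ * ⌊y.im / δ⌋) y.im x.im
    rw [abs_sub_comm y.im] at this
    linarith [hdist y.im]
  have hwx := hmem (hxr.trans (by linarith)) (hxi.trans (by linarith))
  have hwm := hmem hyr (hxi.trans (by linarith))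
  have hwy := hmem hyr hyi
  have hB := hball hx
  have hBc := convex_ball x ε
  have hxB : x ∈ Metric.ball x ε := Metric.mem_ball_self hε
  have hyB : y ∈ Metric.ball x ε := by rw [Metric.mem_ball']; linarith
  have hxR := hfloor ((Complex.abs_re_le_norm x).trans (hR x hx))
  have hxI := hfloor ((Complex.abs_im_le_norm x).trans (hR x hx))
  have hyR := hfloor ((Complex.abs_re_le_norm y).trans (hR y hy))
  have hyI := hfloor ((Complex.abs_im_le_norm y).trans (hR y hy))
  beta_reduce
  rw [← hstep hB hBc (hclose hre) (hclose him) hxR.1 hxR.2 hxI.1 hxI.2 hyR.1 hyR.2 hyI.1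
    hwx hwm hwy, mul_assoc, mul_assoc, hg _ hB hBc _ hwx _ hxB _ hyB,
    hg _ hB hBc _ hwx _ hwy _ hyB]

/-- Two paths with the same end points in a convex subset of a set `U` are homotopic in `U`. -/
theorem homotopic_of_mem_convex {U B : Set ℂ} (hB : B ⊆ U) (hBc : Convex ℝ B) {x y : U}
    (p q : Path x y) (hp : ∀ t, (p t : ℂ) ∈ B) (hq : ∀ t, (q t : ℂ) ∈ B) : p.Homotopic q := by
  have hmem (a : unitInterval × unitInterval) :
      (1 - a.1 : ℝ) • (p a.2 : ℂ) + (a.1 : ℝ) • (q a.2 : ℂ) ∈ B :=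
    hBc (hp _) (hq _) (by linarith [a.1.2.2]) a.1.2.1 (by ring)
  refine ⟨{ toFun := fun a ↦ ⟨_, hB (hmem a)⟩, continuous_toFun := ?_, map_zero_left := ?_,
            map_one_left := ?_, prop' := ?_ }⟩
  · fun_prop
  · simp
  · simp
  · rintro t a (rfl | rfl) <;> ext <;> simp <;> ring

theorem exists_path_mem_of_convex {U B : Set ℂ} (hB : B ⊆ U) (hBc : Convex ℝ B) {x y : U}
    (hx : (x : ℂ) ∈ B) (hy : (y : ℂ) ∈ B) : ∃ p : Path x y, ∀ t, (p t : ℂ) ∈ B := by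
  have hmem (t : unitInterval) : Path.segment (x : ℂ) y t ∈ B := by
    refine hBc.segment_subset hx hy ?_
    rw [← Path.range_segment]
    exact mem_range_self t
  exact ⟨{ toFun := fun t ↦ ⟨Path.segment (x : ℂ) y t, hB (hmem t)⟩
           source' := by ext; simp
           target' := by ext; simp }, hmem⟩

open CategoryTheory in
/-- A choice of homotopy classes of paths between the points of a path connected set which agrees
with that of any path contained in a convex subset. -/
theorem exists_pathClass {U : Set ℂ} [PathConnectedSpace U] :
    ∃ s : ∀ x y : U, FundamentalGroupoid.mk x ⟶ FundamentalGroupoid.mk y,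
      ∀ B ⊆ U, Convex ℝ B → ∀ (x y : U) (p : Path x y), (∀ t, (p t : ℂ) ∈ B) →
        s x y = Path.Homotopic.Quotient.mk p := by
  have key (x y : U) : ∃ s : FundamentalGroupoid.mk x ⟶ FundamentalGroupoid.mk y,
      ∀ B ⊆ U, Convex ℝ B → ∀ p : Path x y, (∀ t, (p t : ℂ) ∈ B) →
        s = Path.Homotopic.Quotient.mk p := by
    by_cases h : segment ℝ (x : ℂ) y ⊆ U
    · obtain ⟨ℓ, hℓ⟩ := exists_path_mem_of_convex h (convex_segment _ _)
        (left_mem_segment ℝ _ _) (right_mem_segment ℝ _ _)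
      refine ⟨Path.Homotopic.Quotient.mk ℓ, fun B hB hBc p hp ↦ ?_⟩
      refine Path.Homotopic.Quotient.eq.2 (homotopic_of_mem_convex hB hBc _ _ (fun t ↦ ?_) hp)
      have hx : (x : ℂ) ∈ B := by simpa using hp 0
      have hy : (y : ℂ) ∈ B := by simpa using hp 1
      exact hBc.segment_subset hx hy (hℓ t)
    · refine ⟨Path.Homotopic.Quotient.mk (PathConnectedSpace.somePath x y),
        fun B hB hBc p hp ↦ absurd ?_ h⟩
      have hx : (x : ℂ) ∈ B := by simpa using hp 0
      have hy : (y : ℂ) ∈ B := by simpa using hp 1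
      exact (hBc.segment_subset hx hy).trans hB
  choose s hs using key
  exact ⟨s, fun B hB hBc x y ↦ hs x y B hB hBc⟩

open CategoryTheory in
/-- A connected open subset of the plane is simply connected if its complement has no nonempty
compact relatively open subset. -/
theorem simplyConnectedSpace_of_isOpen {U : Set ℂ} (hU : IsOpen U) (hUc : IsConnected U)
    (hF : ∀ A ⊆ Uᶜ, IsCompact A → IsClosed (Uᶜ \ A) → A = ∅) : SimplyConnectedSpace U := by
  have hpc : PathConnectedSpace U :=
    isPathConnected_iff_pathConnectedSpace.1 (hU.isConnected_iff_isPathConnected.1 hUc)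
  refine simply_connected_iff_loops_nullhomotopic.2 ⟨hpc, fun x₀ γ ↦ ?_⟩
  obtain ⟨s, hs⟩ := exists_pathClass (U := U)
  have hs_comp {B : Set ℂ} (hB : B ⊆ U) (hBc : Convex ℝ B) {x y z : U} (hx : (x : ℂ) ∈ B)
      (hy : (y : ℂ) ∈ B) (hz : (z : ℂ) ∈ B) : s x y ≫ s y z = s x z := by
    obtain ⟨p, hp⟩ := exists_path_mem_of_convex hB hBc hx hy
    obtain ⟨q, hq⟩ := exists_path_mem_of_convex hB hBc hy hz
    rw [hs B hB hBc _ _ p hp, hs B hB hBc _ _ q hq, hs B hB hBc _ _ (p.trans q)]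
    · rfl
    · intro t
      rw [Path.trans_apply]
      split_ifs
      exacts [hp _, hq _]
  have p (x : U) : FundamentalGroupoid.mk x₀ ⟶ FundamentalGroupoid.mk x :=
    Path.Homotopic.Quotient.mk (PathConnectedSpace.somePath x₀ x)
  let L (x y : U) : End (FundamentalGroupoid.mk x₀) := p x ≫ s x y ≫ inv (p y)
  classical
  let g (a b : ℂ) : End (FundamentalGroupoid.mk x₀) :=
    if h : a ∈ U ∧ b ∈ U then L ⟨b, h.2⟩ ⟨a, h.1⟩ else 1
  have hg (x y : U) : g x y = L y x := by simp [g]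
  obtain ⟨φ, η, hη, hφ⟩ := exists_potential hU hF g (fun B hB hBc x hx y hy z hz ↦ by
    lift x to U using hB hx
    lift y to U using hB hy
    lift z to U using hB hz
    rw [hg, hg, hg, End.mul_def]
    simp [L, ← hs_comp hB hBc hz hy hx]) (K := range fun t ↦ (γ t : ℂ))
    (isCompact_range (by fun_prop)) (by rintro _ ⟨t, rfl⟩; exact (γ t).2)
  let f (t : unitInterval) : FundamentalGroupoid.mk (γ 0) ⟶ FundamentalGroupoid.mk x₀ :=
    Path.Homotopic.Quotient.mk (γ.subpath 0 t) ≫ inv (p (γ t)) ≫ φ (γ t)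
  have hf : IsLocallyConstant f := by
    rw [IsLocallyConstant.iff_eventually_eq]
    intro t₀
    obtain ⟨ε, hε, hεU⟩ := Metric.isOpen_iff.1 hU _ (γ t₀).2
    have hcont : Continuous fun t ↦ (γ t : ℂ) := by fun_prop
    obtain ⟨b, c, hbc, hnhds, hsub⟩ := exists_Icc_mem_subset_of_mem_nhds
      (hcont.continuousAt.preimage_mem_nhds (Metric.ball_mem_nhds _ (lt_min hε hη)))
    filter_upwards [hnhds] with t ht
    have hp : ∀ u, ((γ.subpath t₀ t) u : ℂ) ∈ Metric.ball (γ t₀ : ℂ) ε := by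
      intro u
      have hu : γ.subpath t₀ t u ∈ γ '' uIcc t₀ t := by
        rw [← Path.range_subpath]; exact mem_range_self u
      obtain ⟨v, hv, hvu⟩ := hu
      rw [← hvu]
      exact Metric.ball_subset_ball (min_le_left _ _) (hsub (uIcc_subset_Icc hbc ht hv))
    have hη' : dist (γ t : ℂ) (γ t₀) < η :=
      (Metric.mem_ball.1 (hsub ht)).trans_le (min_le_right _ _)
    have h₁ := hφ _ (mem_range_self t) _ (mem_range_self t₀) hη'
    have h₂ := hs _ hεU (convex_ball _ _) _ _ _ hp
    have h₃ : (Path.Homotopic.Quotient.mk (γ.subpath 0 t) :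
        FundamentalGroupoid.mk (γ 0) ⟶ FundamentalGroupoid.mk (γ t)) =
        Path.Homotopic.Quotient.mk (γ.subpath 0 t₀) ≫ s (γ t₀) (γ t) := by
      rw [h₂]
      exact (Path.Homotopic.Quotient.eq.2 ⟨Path.Homotopy.subpathTransSubpath γ 0 t₀ t⟩).symm
    simp only [f]
    rw [← h₁, h₃, hg, End.mul_def]
    simp [L]
  have h01 := hf.apply_eq_of_isPreconnected isPreconnected_univ (mem_univ 1) (mem_univ 0)
  have hcast {a b : U} (ha : a = x₀) (hb : b = x₀)
      (N : FundamentalGroupoid.mk a ⟶ FundamentalGroupoid.mk b)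
      (h : N ≫ inv (p b) ≫ φ b = inv (p a) ≫ φ a) :
      Path.Homotopic.Quotient.cast N ha.symm hb.symm = Path.Homotopic.Quotient.refl x₀ := by
    subst ha hb
    have : N = 𝟙 _ := (cancel_mono (inv (p b) ≫ φ b)).1 (by rw [h, Category.id_comp])
    rw [this]
    rfl
  have hid : Path.Homotopic.Quotient.mk (γ.subpath 0 0) =
      𝟙 (FundamentalGroupoid.mk (γ 0)) := by
    rw [Path.subpath_self]; rfl
  simp only [f] at h01
  rw [hid, Category.id_comp] at h01
  have := hcast γ.source γ.target _ h01
  rw [Path.subpath_zero_one] at this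
  exact Path.Homotopic.Quotient.eq.1 this

/-- The complement of any point of the Riemann sphere is a plane. -/
theorem exists_isOpenEmbedding_range_eq_compl (z : RSphere) :
    ∃ f : ℂ → RSphere, Topology.IsOpenEmbedding f ∧ range f = {z}ᶜ := by
  let e : RSphere ≃ₜ Metric.sphere (0 : EuclideanSpace ℝ (Fin 3)) 1 :=
    onePointEquivSphereOfFinrankEq (by simp)
  have hv : ‖(e z : EuclideanSpace ℝ (Fin 3))‖ = 1 := by simp
  have hv₀ : (e z : EuclideanSpace ℝ (Fin 3)) ≠ 0 := fun h ↦ by simp [h] at hv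
  have : Fact (Module.finrank ℝ (EuclideanSpace ℝ (Fin 3)) = 2 + 1) := ⟨by simp⟩
  have hd : Module.finrank ℝ ℂ =
      Module.finrank ℝ (Submodule.span ℝ {(e z : EuclideanSpace ℝ (Fin 3))})ᗮ := by
    rw [Complex.finrank_real_complex, Submodule.finrank_orthogonal_span_singleton (n := 2) hv₀]
  let l := (FiniteDimensional.nonempty_continuousLinearEquiv_of_finrank_eq hd).some
  refine ⟨e.symm ∘ (stereographic hv).symm ∘ l, e.symm.isOpenEmbedding.comp
    ((isOpenEmbedding_stereographic_symm hv).comp l.toHomeomorph.isOpenEmbedding), ?_⟩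
  rw [range_comp, l.surjective.range_comp, range_stereographic_symm hv (by simp),
    image_compl_eq e.symm.bijective]
  simp

/-- A connected set punctured at a point whose complement is a plane has no nonempty compact
relatively open subset in this plane. -/
theorem eq_empty_of_isCompact_of_isClosed_diff {X : Type*} [TopologicalSpace X] [T2Space X]
    {f : ℂ → X} (hf : Topology.IsOpenEmbedding f) {z : X} (hz : range f = {z}ᶜ) {C : Set X}
    (hC : IsPreconnected C) (hzC : z ∈ C) {A : Set ℂ} (hA : A ⊆ f ⁻¹' C) (hAc : IsCompact A)
    (hAC : IsClosed (f ⁻¹' C \ A)) : A = ∅ := by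
  by_contra hne
  have hfz (w : ℂ) : f w ≠ z := by
    have := mem_range_self (f := f) w
    rw [hz] at this
    exact this
  have h₁ : IsClosed (f '' A) := (hAc.image hf.continuous).isClosed
  have h₂ : IsOpen (f '' (f ⁻¹' C \ A)ᶜ) := hf.isOpenMap _ hAC.isOpen_compl
  obtain ⟨a, ha⟩ := nonempty_iff_ne_empty.2 hne
  have hcover : C ⊆ f '' (f ⁻¹' C \ A)ᶜ ∪ (f '' A)ᶜ := fun x _ ↦ by
    by_cases hxA : x ∈ f '' A
    · obtain ⟨w, hw, rfl⟩ := hxA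
      exact .inl ⟨w, fun h ↦ h.2 hw, rfl⟩
    · exact .inr hxA
  obtain ⟨x, hxC, ⟨w, hw, rfl⟩, hx⟩ := hC _ _ h₂ h₁.isOpen_compl hcover
    ⟨f a, hA ha, a, fun h ↦ h.2 ha, rfl⟩ ⟨z, hzC, fun ⟨w, _, hw⟩ ↦ hfz w hw⟩
  exact hw ⟨hxC, fun h ↦ hx ⟨w, h, rfl⟩⟩

theorem separation_one_point
    (C₁ C₂ : Set RSphere) (z : RSphere)
    (h₁ : IsContinuum C₁) (h₂ : IsContinuum C₂)
    (hn₁ : NonSeparating C₁) (hn₂ : NonSeparating C₂)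
    (hinter : C₁ ∩ C₂ = {z}) :
    (C₁ ∪ C₂)ᶜ.Nonempty ∧ IsConnected (C₁ ∪ C₂)ᶜ ∧
      SimplyConnectedSpace ((C₁ ∪ C₂)ᶜ : Set RSphere) := by
  obtain ⟨f, hf, hfr⟩ := exists_isOpenEmbedding_range_eq_compl z
  have hz : z ∈ C₁ ∩ C₂ := hinter ▸ mem_singleton z
  have hsub {C : Set RSphere} (hC : z ∈ C) : Cᶜ ⊆ range f := by
    rw [hfr]
    exact compl_subset_compl.2 (singleton_subset_iff.2 hC)
  have hcl₁ : IsClosed (f ⁻¹' C₁) := h₁.2.1.isClosed.preimage hf.continuous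
  have hcl₂ : IsClosed (f ⁻¹' C₂) := h₂.2.1.isClosed.preimage hf.continuous
  have hpre {C : Set RSphere} (hC : z ∈ C) (hn : NonSeparating C) : IsConnected (f ⁻¹' C)ᶜ := by
    have himg : f '' (f ⁻¹' C)ᶜ = Cᶜ := by
      rw [← preimage_compl, image_preimage_eq_of_subset (hsub hC)]
    have hne := hn.1
    rw [← himg] at hne
    refine ⟨hne.of_image, ?_⟩
    rw [← hf.isInducing.isPreconnected_image, himg]
    exact hn.2.isPreconnected
  have hd : Disjoint (f ⁻¹' C₁) (f ⁻¹' C₂) := by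
    rw [disjoint_iff_inter_eq_empty, ← preimage_inter, hinter,
      preimage_singleton_eq_empty, hfr]
    simp
  set U := (f ⁻¹' C₁ ∪ f ⁻¹' C₂)ᶜ with hU
  have hUo : IsOpen U := (hcl₁.union hcl₂).isOpen_compl
  have himg : f '' U = (C₁ ∪ C₂)ᶜ := by
    rw [hU, ← preimage_union, ← preimage_compl, image_preimage_eq_of_subset (hsub (.inl hz.1))]
  have hUne : U.Nonempty := by
    rw [hU, nonempty_compl]
    intro huniv
    have hco : (f ⁻¹' C₁)ᶜ = f ⁻¹' C₂ := (IsCompl.of_eq hd.eq_bot huniv).compl_eq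
    have hclopen : IsClopen (f ⁻¹' C₂) := ⟨hcl₂, hco ▸ hcl₁.isOpen_compl⟩
    rcases isClopen_iff.1 hclopen with h | h
    · exact (hpre hz.1 hn₁).nonempty.ne_empty (hco.trans h)
    · exact (hpre hz.2 hn₂).nonempty.ne_empty (by rw [h, compl_univ])
  have hUc : IsConnected U := ⟨hUne, isPreconnected_compl_union hcl₁ hcl₂ hd
    (hpre hz.1 hn₁).isPreconnected (hpre hz.2 hn₂).isPreconnected⟩
  have hCc : IsPreconnected (C₁ ∪ C₂) :=
    IsPreconnected.union z hz.1 hz.2 h₁.2.2.isPreconnected h₂.2.2.isPreconnected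
  have hsc : IsSimplyConnected U := simplyConnectedSpace_of_isOpen hUo hUc fun A hA hAc hAcl ↦ by
    rw [hU, compl_compl, ← preimage_union] at hA hAcl
    exact eq_empty_of_isCompact_of_isClosed_diff hf hfr hCc (.inl hz.1) hA hAc hAcl
  rw [← himg]
  exact ⟨hUne.image f, hUc.image f hf.continuous.continuousOn,
    hf.isEmbedding.isSimplyConnected_image.2 hsc⟩
end

section
/- Let C₁, C₂ be non-separating continua in the Riemann sphere Ĉ such that C₁ ∩ C₂ = {z, w} for two distinct points z, w ∈ Ĉ. Then the complement Ĉ ∖ (C₁ ∪ C₂) has exactly two connected components, and each of these components is open and simply connected (as a topological subspace). -/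
open Set

section

open Filter Topology Metric OnePoint

open scoped ComplexConjugate

theorem exists_int_eqOn_of_exp_eq {X : Type*} [TopologicalSpace X] {s : Set X}
    (hs : IsPreconnected s) {f g : X → ℂ} (hf : ContinuousOn f s) (hg : ContinuousOn g s)
    (h : ∀ x ∈ s, Complex.exp (f x) = Complex.exp (g x)) :
    ∃ n : ℤ, ∀ x ∈ s, f x = g x + n * (2 * Real.pi * Complex.I) := by
  have hd : IsDiscrete (AddSubgroup.zmultiples (2 * Real.pi * Complex.I : ℂ) : Set ℂ) :=
    isDiscrete_iff_discreteTopology.2 (NormedSpace.discreteTopology_zmultiples _)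
  have hm : MapsTo (fun x => f x - g x) s
      (AddSubgroup.zmultiples (2 * Real.pi * Complex.I : ℂ) : Set ℂ) := by
    intro x hx
    obtain ⟨n, hn⟩ := Complex.exp_eq_exp_iff_exists_int.1 (h x hx)
    refine AddSubgroup.mem_zmultiples_iff.2 ⟨n, ?_⟩
    simp [hn]
  obtain ⟨y, hy, hfy⟩ := hs.eqOn_const_of_mapsTo hd (hf.sub hg) hm ⟨0, zero_mem _⟩
  obtain ⟨n, rfl⟩ := AddSubgroup.mem_zmultiples_iff.1 hy
  refine ⟨n, fun x hx => ?_⟩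
  have := hfy hx
  simp only [Pi.sub_apply, Function.const, zsmul_eq_mul] at this
  linear_combination this

theorem eqOn_of_exp_eq {X : Type*} [TopologicalSpace X] {s : Set X}
    (hs : IsPreconnected s) {f g : X → ℂ} (hf : ContinuousOn f s) (hg : ContinuousOn g s)
    (h : ∀ x ∈ s, Complex.exp (f x) = Complex.exp (g x)) {x₀ : X} (hx₀ : x₀ ∈ s)
    (h₀ : f x₀ = g x₀) : EqOn f g s := by
  obtain ⟨n, hn⟩ := exists_int_eqOn_of_exp_eq hs hf hg h
  have hn0 : (n : ℂ) * (2 * Real.pi * Complex.I) = 0 := by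
    linear_combination h₀ - hn x₀ hx₀
  intro x hx
  rw [hn x hx, hn0, add_zero]

/-- The function `x ↦ x - p` has a continuous logarithm on `L`. -/
def HasLogSub (L : Set ℂ) (p : ℂ) : Prop :=
  ∃ g : ℂ → ℂ, ContinuousOn g L ∧ ∀ x ∈ L, Complex.exp (g x) = x - p

theorem HasLogSub.of_norm_lt {L : Set ℂ} {p q : ℂ} (hp : HasLogSub L p)
    (hpq : ∀ x ∈ L, ‖p - q‖ < ‖x - p‖) : HasLogSub L q := by
  obtain ⟨g, hg, hge⟩ := hp
  have hne : ∀ x ∈ L, x - p ≠ 0 := fun x hx h => by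
    have := hpq x hx
    simp [h] at this
    linarith [norm_nonneg (p - q)]
  have hs : ∀ x ∈ L, 1 + (p - q) / (x - p) ∈ Complex.slitPlane := fun x hx => by
    refine Complex.mem_slitPlane_of_norm_lt_one ?_
    rw [norm_div, div_lt_one (norm_pos_iff.2 (hne x hx))]
    exact hpq x hx
  refine ⟨fun x => g x + Complex.log (1 + (p - q) / (x - p)), ?_, fun x hx => ?_⟩
  · refine hg.add (ContinuousOn.clog ?_ hs)
    exact continuousOn_const.add
      (continuousOn_const.div (continuousOn_id.sub continuousOn_const) hne)
  · rw [Complex.exp_add, hge x hx, Complex.exp_log (Complex.slitPlane_ne_zero (hs x hx))]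
    have := hne x hx
    field_simp
    ring

theorem HasLogSub.of_norm_lt_norm {L : Set ℂ} {p : ℂ} (hp : ∀ x ∈ L, ‖x‖ < ‖p‖) :
    HasLogSub L p := by
  rcases L.eq_empty_or_nonempty with rfl | ⟨y, hy⟩
  · exact ⟨0, continuousOn_empty _, by simp⟩
  have hp0 : p ≠ 0 := norm_pos_iff.1 ((norm_nonneg y).trans_lt (hp y hy))
  have hs : ∀ x ∈ L, 1 + -(x / p) ∈ Complex.slitPlane := fun x hx => by
    refine Complex.mem_slitPlane_of_norm_lt_one ?_
    rw [norm_neg, norm_div, div_lt_one (norm_pos_iff.2 hp0)]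
    exact hp x hx
  refine ⟨fun x => Complex.log (-p) + Complex.log (1 + -(x / p)), ?_, fun x hx => ?_⟩
  · refine continuousOn_const.add (ContinuousOn.clog ?_ hs)
    fun_prop
  · rw [Complex.exp_add, Complex.exp_log (Complex.slitPlane_ne_zero (hs x hx)),
      Complex.exp_log (neg_ne_zero.2 hp0)]
    field_simp
    ring

theorem exists_forall_dist_lt_norm_sub_lt {L : Set ℂ} (hL : IsCompact L) {p : ℂ} (hp : p ∉ L) :
    ∃ r > 0, ∀ q, dist q p < r → q ∉ L ∧
      ∀ x ∈ L, ‖p - q‖ < ‖x - p‖ ∧ ‖q - p‖ < ‖x - q‖ := by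
  obtain ⟨r, hr, hd⟩ := Metric.isOpen_iff.1 hL.isClosed.isOpen_compl p hp
  have hfar : ∀ x ∈ L, r ≤ dist x p := fun x hx => by
    by_contra! h
    exact hd h hx
  refine ⟨r / 2, by positivity, fun q hq => ⟨hd (mem_ball.2 (by linarith)), fun x hx => ?_⟩⟩
  have h1 := hfar x hx
  have h2 := dist_triangle x q p
  rw [← dist_eq_norm, ← dist_eq_norm, ← dist_eq_norm, ← dist_eq_norm, dist_comm p q]
  constructor <;> linarith

theorem hasLogSub_of_isCompact {L : Set ℂ} (hL : IsCompact L) {C : Set (OnePoint ℂ)}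
    (hC : IsPreconnected C) (hinf : ∞ ∈ C) {a : ℂ} (ha : (a : OnePoint ℂ) ∈ C)
    (hCL : ∀ x ∈ L, (x : OnePoint ℂ) ∉ C) : HasLogSub L a := by
  set S : Set ℂ := {p | p ∉ L ∧ HasLogSub L p} with hS
  set T : Set ℂ := {p | p ∉ L ∧ ¬ HasLogSub L p} with hT
  obtain ⟨R, hR⟩ := hL.isBounded.exists_norm_le
  have hSo : IsOpen S := by
    refine Metric.isOpen_iff.2 fun p hp => ?_
    obtain ⟨r, hr, h⟩ := exists_forall_dist_lt_norm_sub_lt hL hp.1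
    exact ⟨r, hr, fun q hq => ⟨(h q hq).1, hp.2.of_norm_lt fun x hx => ((h q hq).2 x hx).1⟩⟩
  have hTo : IsOpen T := by
    refine Metric.isOpen_iff.2 fun p hp => ?_
    obtain ⟨r, hr, h⟩ := exists_forall_dist_lt_norm_sub_lt hL hp.1
    exact ⟨r, hr, fun q hq => ⟨(h q hq).1, fun hq' =>
      hp.2 (hq'.of_norm_lt fun x hx => ((h q hq).2 x hx).2)⟩⟩
  have hbig : ∀ p : ℂ, R < ‖p‖ → p ∈ S := fun p hp =>
    ⟨fun h => (hR p h).not_gt hp, .of_norm_lt_norm fun x hx => (hR x hx).trans_lt hp⟩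
  have hSo' : IsOpen (insert ∞ ((↑) '' S) : Set (OnePoint ℂ)) := by
    rw [OnePoint.isOpen_iff_of_mem (by simp)]
    have : ((↑) ⁻¹' (insert ∞ ((↑) '' S) : Set (OnePoint ℂ)) : Set ℂ) = S := by
      ext x; simp
    rw [this]
    refine ⟨hSo.isClosed_compl, ?_⟩
    refine (isCompact_closedBall (0 : ℂ) R).of_isClosed_subset hSo.isClosed_compl fun x hx => ?_
    by_contra h
    exact hx (hbig x (by simpa using h))
  have hsub := hC.subset_left_of_subset_union hSo' (isOpenMap_coe T hTo) ?_ ?_ ⟨∞, hinf, by simp⟩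
  · have := hsub ha
    simp only [mem_insert_iff, coe_ne_infty, false_or, mem_image, coe_eq_coe] at this
    obtain ⟨p, hp, rfl⟩ := this
    exact hp.2
  · rw [Set.disjoint_left]
    rintro _ (rfl | ⟨x, hx, rfl⟩) ⟨y, hy, h⟩
    · exact coe_ne_infty _ h
    · rw [coe_eq_coe.1 h] at hy
      exact hy.2 hx.2
  · intro p hp
    induction p using OnePoint.rec with
    | infty => simp
    | coe p =>
      have hpL : p ∉ L := fun h => hCL p h hp
      by_cases h : HasLogSub L p
      · exact Or.inl (Or.inr ⟨p, ⟨hpL, h⟩, rfl⟩)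
      · exact Or.inr ⟨p, ⟨hpL, h⟩, rfl⟩

theorem exists_isCompact_isPreconnected_mem_nhds {E : Type*} [NormedAddCommGroup E]
    [NormedSpace ℝ E] [FiniteDimensional ℝ E] {U : Set E} (hU : IsOpen U)
    (hUc : IsConnected U) {x y : E} (hx : x ∈ U) (hy : y ∈ U) :
    ∃ L ⊆ U, IsCompact L ∧ IsPreconnected L ∧ x ∈ L ∧ L ∈ 𝓝 y := by
  obtain ⟨γ, hγ⟩ := ((hU.isConnected_iff_isPathConnected).1 hUc).joinedIn x hx y hy
  obtain ⟨r, hr, hball⟩ := Metric.nhds_basis_closedBall.mem_iff.1 (hU.mem_nhds hy)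
  have := FiniteDimensional.proper ℝ E
  refine ⟨range γ ∪ closedBall y r, union_subset (by rintro _ ⟨t, rfl⟩; exact hγ t) hball,
    (isCompact_range γ.continuous).union (isCompact_closedBall _ _), ?_,
    Or.inl ⟨0, γ.source⟩, mem_of_superset (closedBall_mem_nhds y hr) subset_union_right⟩
  exact IsPreconnected.union y ⟨1, γ.target⟩ (mem_closedBall_self hr.le)
    (isPreconnected_range γ.continuous) (convex_closedBall y r).isPreconnected

theorem HasLogSub.of_forall_isCompact {U : Set ℂ} (hU : IsOpen U) (hUc : IsConnected U) {a : ℂ}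
    (ha : a ∉ U) (h : ∀ L ⊆ U, IsCompact L → HasLogSub L a) : HasLogSub U a := by
  obtain ⟨x₀, hx₀⟩ := hUc.nonempty
  have hL : ∀ L ⊆ U, IsCompact L → x₀ ∈ L → ∃ g : ℂ → ℂ, ContinuousOn g L ∧
      (∀ x ∈ L, Complex.exp (g x) = x - a) ∧ g x₀ = Complex.log (x₀ - a) := by
    intro L hLU hLc hx
    obtain ⟨g, hg, hge⟩ := h L hLU hLc
    refine ⟨fun x => g x + (Complex.log (x₀ - a) - g x₀), hg.add continuousOn_const,
      fun x hxL => ?_, by ring⟩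
    have h0 : x₀ - a ≠ 0 := sub_ne_zero.2 (ne_of_mem_of_not_mem hx₀ ha)
    rw [Complex.exp_add, Complex.exp_sub, Complex.exp_log h0, hge x hxL, hge x₀ hx, div_self h0,
      mul_one]
  choose! K hKU hKc hKp hxK hKn using
    fun y (hy : y ∈ U) => exists_isCompact_isPreconnected_mem_nhds hU hUc hx₀ hy
  choose! g hgc hge hg0 using fun y (hy : y ∈ U) => hL (K y) (hKU y hy) (hKc y hy) (hxK y hy)
  have key : ∀ x ∈ U, ∀ y ∈ U, ∀ t ∈ K x, t ∈ K y → g x t = g y t := by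
    intro x hx y hy t htx hty
    obtain ⟨k, hk, hke, hk0⟩ := hL (K x ∪ K y) (union_subset (hKU x hx) (hKU y hy))
      ((hKc x hx).union (hKc y hy)) (Or.inl (hxK x hx))
    have h1 := eqOn_of_exp_eq (hKp x hx) (hgc x hx) (hk.mono subset_union_left)
      (fun s hs => by rw [hge x hx s hs, hke s (Or.inl hs)]) (hxK x hx)
      ((hg0 x hx).trans hk0.symm) htx
    have h2 := eqOn_of_exp_eq (hKp y hy) (hgc y hy) (hk.mono subset_union_right)
      (fun s hs => by rw [hge y hy s hs, hke s (Or.inr hs)]) (hxK y hy)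
      ((hg0 y hy).trans hk0.symm) hty
    exact h1.trans h2.symm
  refine ⟨fun x => g x x, fun x hx => ?_, fun x hx => hge x hx x (mem_of_mem_nhds (hKn x hx))⟩
  refine ContinuousAt.continuousWithinAt ?_
  refine ((hgc x hx).continuousAt (hKn x hx)).congr ?_
  filter_upwards [hKn x hx, hU.mem_nhds hx] with y hyK hyU
  exact key x hx y hyU y hyK (mem_of_mem_nhds (hKn y hyU))

/-- If a connected subset of the sphere joins `a` to `∞` outside a planar domain `U`, then
`x ↦ x - a` has a continuous logarithm on `U`. -/
theorem hasLogSub_of_isPreconnected {U : Set ℂ} (hU : IsOpen U) (hUc : IsConnected U)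
    {C : Set (OnePoint ℂ)} (hC : IsPreconnected C) (hinf : ∞ ∈ C) {a : ℂ}
    (ha : (a : OnePoint ℂ) ∈ C) (hCU : ∀ x ∈ U, (x : OnePoint ℂ) ∉ C) : HasLogSub U a :=
  .of_forall_isCompact hU hUc (fun h => hCU a h ha) fun _ hLU hL =>
    hasLogSub_of_isCompact hL hC hinf ha fun x hx => hCU x (hLU hx)

theorem not_hasLogSub_compl_zero : ¬ HasLogSub {0}ᶜ 0 := by
  rintro ⟨g, hg, hge⟩
  have hc : Continuous fun t : ℝ => Complex.exp (t * Complex.I) := by fun_prop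
  obtain ⟨n, hn⟩ := exists_int_eqOn_of_exp_eq (s := (univ : Set ℝ)) isPreconnected_univ
    (f := fun t : ℝ => g (Complex.exp (t * Complex.I))) (g := fun t : ℝ => t * Complex.I)
    (hg.comp hc.continuousOn fun t _ => Complex.exp_ne_zero _) (by fun_prop)
    (fun t _ => by rw [hge _ (Complex.exp_ne_zero _), sub_zero])
  have h0 := hn 0 trivial
  have h1 := hn (2 * Real.pi) trivial
  push_cast at h0 h1
  rw [Complex.exp_two_pi_mul_I] at h1
  rw [zero_mul, Complex.exp_zero] at h0
  exact Complex.two_pi_I_ne_zero (by linear_combination h0 - h1)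

theorem not_isPreconnected_inter {U₁ U₂ : Set ℂ} (h₁ : IsOpen U₁) (h₂ : IsOpen U₂)
    (hU : U₁ ∪ U₂ = {0}ᶜ) (hl₁ : HasLogSub U₁ 0) (hl₂ : HasLogSub U₂ 0) :
    ¬ IsPreconnected (U₁ ∩ U₂) := by
  classical
  intro hp
  obtain ⟨g₁, hg₁, he₁⟩ := hl₁
  obtain ⟨g₂, hg₂, he₂⟩ := hl₂
  obtain ⟨n, hn⟩ := exists_int_eqOn_of_exp_eq hp (hg₁.mono inter_subset_left)
    (hg₂.mono inter_subset_right) fun x hx => by rw [he₁ x hx.1, he₂ x hx.2]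
  set g : ℂ → ℂ := fun x => if x ∈ U₁ then g₁ x else g₂ x + n * (2 * Real.pi * Complex.I) with hg
  have e₁ : EqOn g g₁ U₁ := fun x hx => if_pos hx
  have e₂ : EqOn g (fun x => g₂ x + n * (2 * Real.pi * Complex.I)) U₂ := fun x hx => by
    by_cases hx1 : x ∈ U₁
    · rw [e₁ hx1]; exact hn x ⟨hx1, hx⟩
    · exact if_neg hx1
  refine not_hasLogSub_compl_zero ⟨g, ?_, ?_⟩
  · rw [← hU]
    exact (hg₁.congr e₁).union_of_isOpen ((hg₂.add continuousOn_const).congr e₂) h₁ h₂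
  · rw [← hU]
    rintro x (hx | hx)
    · rw [e₁ hx, he₁ x hx]
    · rw [e₂ hx, Complex.exp_add, Complex.exp_int_mul_two_pi_mul_I, mul_one, he₂ x hx]

theorem exists_continuous_exp_eq {F : ℂ → ℂ} (hF : Continuous F) (h0 : ∀ x, F x ≠ 0) :
    ∃ L : ℂ → ℂ, Continuous L ∧ ∀ x, Complex.exp (L x) = F x := by
  have hs : IsSimplyConnected (univ : Set ℂ) :=
    (Homeomorph.Set.univ ℂ).toHomotopyEquiv.simplyConnectedSpace_iff.2 inferInstance
  obtain ⟨L, hL, he⟩ := Complex.exists_continuousOn_eqOn_exp_comp hs isOpen_univ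
    hF.continuousOn (by rintro ⟨x, -, hx⟩; exact h0 x hx)
  exact ⟨L, continuousOn_univ.1 hL, fun x => he (mem_univ x)⟩

theorem exists_indicator_eq_mul_sub_add {U₁ U₂ : Set ℂ} (h₁ : IsOpen U₁) (h₂ : IsOpen U₂)
    (hc₁ : IsPreconnected U₁) (hc₂ : IsPreconnected U₂) (hU : U₁ ∪ U₂ = {0}ᶜ) {g₁ g₂ : ℂ → ℂ}
    (hg₁ : ContinuousOn g₁ U₁) (he₁ : ∀ x ∈ U₁, Complex.exp (g₁ x) = x)
    (hg₂ : ContinuousOn g₂ U₂) (he₂ : ∀ x ∈ U₂, Complex.exp (g₂ x) = x)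
    {D : Set ℂ} (hD : IsOpen D) (hDU : D ⊆ U₁ ∩ U₂) (hD' : IsOpen ((U₁ ∩ U₂) \ D)) :
    ∃ (n : ℤ) (c : ℂ), ∀ x ∈ U₁ ∩ U₂,
      D.indicator 1 x * (2 * Real.pi * Complex.I) = n * (g₁ x - g₂ x) + c := by
  have z₁ : (0 : ℂ) ∈ U₁ᶜ := fun h => (hU.subset (Or.inl h)) rfl
  have z₂ : (0 : ℂ) ∈ U₂ᶜ := fun h => (hU.subset (Or.inr h)) rfl
  set d₁ : ℂ → ℝ := fun x => infDist x U₁ᶜ with hd₁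
  set d₂ : ℂ → ℝ := fun x => infDist x U₂ᶜ with hd₂
  have hd₁c : Continuous d₁ := continuous_infDist_pt _
  have hd₂c : Continuous d₂ := continuous_infDist_pt _
  have n₁ : ∀ x, 0 ≤ d₁ x := fun x => infDist_nonneg
  have n₂ : ∀ x, 0 ≤ d₂ x := fun x => infDist_nonneg
  have p₁ : ∀ x ∈ U₁, 0 < d₁ x := fun x hx =>
    (h₁.isClosed_compl.notMem_iff_infDist_pos ⟨0, z₁⟩).1 fun h => h hx
  have p₂ : ∀ x ∈ U₂, 0 < d₂ x := fun x hx =>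
    (h₂.isClosed_compl.notMem_iff_infDist_pos ⟨0, z₂⟩).1 fun h => h hx
  have q₁ : ∀ x, x ∉ U₁ → d₁ x = 0 := fun x hx => infDist_zero_of_mem hx
  have q₂ : ∀ x, x ∉ U₂ → d₂ x = 0 := fun x hx => infDist_zero_of_mem hx
  set μ : ℂ → ℝ := fun x => d₂ x / (d₁ x + d₂ x) with hμ
  have hpos : ∀ x ∈ U₁ ∪ U₂, d₁ x + d₂ x ≠ 0 := by
    rintro x (hx | hx)
    · exact (add_pos_of_pos_of_nonneg (p₁ x hx) (n₂ x)).ne'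
    · exact (add_pos_of_nonneg_of_pos (n₁ x) (p₂ x hx)).ne'
  have hμc : ∀ x ∈ U₁ ∪ U₂, ContinuousAt μ x := fun x hx =>
    hd₂c.continuousAt.div (hd₁c.add hd₂c).continuousAt (hpos x hx)
  have hgen : ∀ ν : ℂ → ℂ, ∀ A B : Set ℂ, A ∩ B = U₁ ∩ U₂ → IsOpen A → IsOpen B →
      (∀ x ∈ A, ContinuousAt ν x) → (∀ x ∈ A, x ∉ B → ν x = 0) →
      ContinuousOn (D.indicator ν) A := by
    intro ν A B hAB hA hB hν hνz x hx
    refine ContinuousAt.continuousWithinAt ?_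
    by_cases hxB : x ∈ B
    · by_cases hxD : x ∈ D
      · refine (hν x hx).congr ?_
        filter_upwards [hD.mem_nhds hxD] with y hy
        rw [indicator_of_mem hy]
      · refine (continuousAt_const (y := (0 : ℂ))).congr ?_
        have : x ∈ (U₁ ∩ U₂) \ D := ⟨hAB ▸ ⟨hx, hxB⟩, hxD⟩
        filter_upwards [hD'.mem_nhds this] with y hy
        rw [indicator_of_notMem hy.2]
    · have h0 : D.indicator ν x = 0 := by
        refine indicator_of_notMem (fun h => hxB ?_) _
        exact (hAB.symm.subset (hDU h)).2
      rw [ContinuousAt, h0]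
      have ht : Tendsto (fun y => ‖ν y‖) (𝓝 x) (𝓝 0) := by
        simpa [hνz x hx hxB] using (hν x hx).norm.tendsto
      exact squeeze_zero_norm (fun y => norm_indicator_le_norm_self ν y) ht
  set τ : ℂ := 2 * Real.pi * Complex.I with hτ
  have hk₁ : ContinuousOn (D.indicator fun x => (μ x : ℂ) * τ) U₁ := by
    refine hgen _ U₁ U₂ rfl h₁ h₂ (fun x hx => ?_) fun x hx hx2 => ?_
    · exact (Complex.continuous_ofReal.continuousAt.comp (hμc x (Or.inl hx))).mul
        continuousAt_const
    · simp [hμ, q₂ x hx2]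
  have hk₂ : ContinuousOn (D.indicator fun x => ((μ x : ℂ) - 1) * τ) U₂ := by
    refine hgen _ U₂ U₁ (inter_comm _ _) h₂ h₁ (fun x hx => ?_) fun x hx hx1 => ?_
    · exact ((Complex.continuous_ofReal.continuousAt.comp (hμc x (Or.inr hx))).sub
        continuousAt_const).mul continuousAt_const
    · have : μ x = 1 := by simp [hμ, q₁ x hx1, (p₂ x hx).ne']
      simp [this]
  set F : ℂ → ℂ := fun x => Complex.exp (D.indicator (fun x => (μ x : ℂ) * τ) x) with hF
  have hF₂ : ∀ x, F x = Complex.exp (D.indicator (fun x => ((μ x : ℂ) - 1) * τ) x) := by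
    intro x
    by_cases hx : x ∈ D
    · simp only [hF, indicator_of_mem hx, sub_mul, one_mul, Complex.exp_sub]
      rw [hτ, Complex.exp_two_pi_mul_I, div_one]
    · simp [hF, indicator_of_notMem hx]
  have hFc : ContinuousOn F {0}ᶜ := by
    rw [← hU]
    refine (Complex.continuous_exp.comp_continuousOn hk₁).union_of_isOpen ?_ h₁ h₂
    exact (Complex.continuous_exp.comp_continuousOn hk₂).congr fun x _ => hF₂ x
  obtain ⟨L, hLc, hLe⟩ := exists_continuous_exp_eq (F := F ∘ Complex.exp)
    (hFc.comp_continuous Complex.continuous_exp fun x => Complex.exp_ne_zero x)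
    (fun x => Complex.exp_ne_zero _)
  obtain ⟨n, hn⟩ := exists_int_eqOn_of_exp_eq (s := (univ : Set ℂ)) isPreconnected_univ
    (f := fun t => L (t + τ)) (g := L) (hLc.comp (continuous_add_const τ)).continuousOn
    hLc.continuousOn fun t _ => by
      simp only [hLe, Function.comp_apply, hτ, Complex.exp_periodic t]
  have hper : ∀ (k : ℤ) (t : ℂ), L (t + k * τ) = L t + k * (n * τ) := by
    intro k
    induction k using Int.induction_on with
    | zero => simp
    | succ k ih =>
      intro t
      have := hn (t + k * τ) trivial
      push_cast at ih ⊢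
      rw [add_mul, one_mul, ← add_assoc, this, ih]
      ring
    | pred k ih =>
      intro t
      have := hn (t + (-k - 1) * τ) trivial
      push_cast at ih ⊢
      rw [show t + (-(k : ℂ) - 1) * τ + τ = t + -k * τ by ring, ih] at this
      linear_combination -this
  obtain ⟨m₁, hm₁⟩ := exists_int_eqOn_of_exp_eq hc₁ (f := L ∘ g₁)
    (hLc.comp_continuousOn hg₁) hk₁ fun x hx => by
      rw [Function.comp_apply, hLe, Function.comp_apply, he₁ x hx]
  obtain ⟨m₂, hm₂⟩ := exists_int_eqOn_of_exp_eq hc₂ (f := L ∘ g₂)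
    (hLc.comp_continuousOn hg₂) hk₂ fun x hx => by
      rw [Function.comp_apply, hLe, Function.comp_apply, he₂ x hx, hF₂]
  refine ⟨n, (m₂ - m₁) * τ, fun x hx => ?_⟩
  obtain ⟨k, hk⟩ := Complex.exp_eq_exp_iff_exists_int.1 ((he₁ x hx.1).trans (he₂ x hx.2).symm)
  have e1 := hm₁ x hx.1
  have e2 := hm₂ x hx.2
  have e3 := hper k (g₂ x)
  rw [← hτ] at e1 e2 hk
  rw [← hk] at e3
  simp only [Function.comp_apply] at e1 e2
  by_cases hxD : x ∈ D
  · simp only [indicator_of_mem hxD, Pi.one_apply] at e1 e2 ⊢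
    linear_combination -e1 + e2 + e3 - n * hk
  · simp only [indicator_of_notMem hxD] at e1 e2 ⊢
    linear_combination -e1 + e2 + e3 - n * hk

theorem ncard_components_inter_eq_two {U₁ U₂ : Set ℂ} (h₁ : IsOpen U₁) (h₂ : IsOpen U₂)
    (hc₁ : IsPreconnected U₁) (hc₂ : IsPreconnected U₂) (hU : U₁ ∪ U₂ = {0}ᶜ)
    (hl₁ : HasLogSub U₁ 0) (hl₂ : HasLogSub U₂ 0) :
    {D : Set ℂ | ∃ x ∈ U₁ ∩ U₂, D = connectedComponentIn (U₁ ∩ U₂) x}.ncard = 2 := by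
  have hnp := not_isPreconnected_inter h₁ h₂ hU hl₁ hl₂
  obtain ⟨g₁, hg₁, he₁⟩ := hl₁
  obtain ⟨g₂, hg₂, he₂⟩ := hl₂
  simp only [sub_zero] at he₁ he₂
  set V := U₁ ∩ U₂ with hV
  have hVo : IsOpen V := h₁.inter h₂
  obtain ⟨x, hx⟩ : V.Nonempty := by
    by_contra! h
    exact hnp (h ▸ isPreconnected_empty)
  obtain ⟨y, hy, hyx⟩ : ∃ y ∈ V, y ∉ connectedComponentIn V x := by
    by_contra! h
    refine hnp ?_
    rw [subset_antisymm h (connectedComponentIn_subset V x)]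
    exact isPreconnected_connectedComponentIn
  have hdiff : ∀ a, IsOpen (V \ connectedComponentIn V a) := by
    intro a
    have : V \ connectedComponentIn V a = ⋃ b ∈ V \ connectedComponentIn V a,
        connectedComponentIn V b := by
      ext t
      simp only [mem_iUnion, exists_prop]
      refine ⟨fun ht => ⟨t, ht, mem_connectedComponentIn ht.1⟩, ?_⟩
      rintro ⟨b, hb, ht⟩
      refine ⟨connectedComponentIn_subset _ _ ht, fun hta => hb.2 ?_⟩
      rw [connectedComponentIn_eq hta, ← connectedComponentIn_eq ht]
      exact mem_connectedComponentIn hb.1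
    rw [this]
    exact isOpen_biUnion fun b _ => hVo.connectedComponentIn
  have hind : ∀ a, ∃ (n : ℤ) (c : ℂ), ∀ t ∈ V, (connectedComponentIn V a).indicator 1 t *
      (2 * Real.pi * Complex.I) = n * (g₁ t - g₂ t) + c := fun a =>
    exists_indicator_eq_mul_sub_add h₁ h₂ hc₁ hc₂ hU hg₁ he₁ hg₂ he₂ hVo.connectedComponentIn
      (connectedComponentIn_subset V a) (hdiff a)
  have hthree : ∀ t ∈ V, t ∉ connectedComponentIn V x → t ∈ connectedComponentIn V y := by
    intro t ht htx
    by_contra hty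
    obtain ⟨n, c, hn⟩ := hind x
    obtain ⟨m, d, hm⟩ := hind y
    have a1 := hn x hx
    have a2 := hn y hy
    have a3 := hn t ht
    have b2 := hm y hy
    have b3 := hm t ht
    rw [indicator_of_mem (mem_connectedComponentIn hx), Pi.one_apply] at a1
    rw [indicator_of_notMem hyx] at a2
    rw [indicator_of_notMem htx] at a3
    rw [indicator_of_mem (mem_connectedComponentIn hy), Pi.one_apply] at b2
    rw [indicator_of_notMem hty] at b3
    have hn0 : (n : ℂ) ≠ 0 := by
      intro h0
      rw [h0] at a1 a2
      exact Complex.two_pi_I_ne_zero (by linear_combination a1 - a2)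
    have e : g₁ y - g₂ y = g₁ t - g₂ t :=
      mul_left_cancel₀ hn0 (by linear_combination a3 - a2)
    rw [e] at b2
    exact Complex.two_pi_I_ne_zero (by linear_combination b2 - b3)
  have : {D : Set ℂ | ∃ x ∈ V, D = connectedComponentIn V x} =
      {connectedComponentIn V x, connectedComponentIn V y} := by
    ext D
    constructor
    · rintro ⟨t, ht, rfl⟩
      by_cases htx : t ∈ connectedComponentIn V x
      · exact Or.inl (connectedComponentIn_eq htx).symm
      · exact Or.inr (connectedComponentIn_eq (hthree t ht htx)).symm
    · rintro (rfl | rfl)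
      · exact ⟨x, hx, rfl⟩
      · exact ⟨y, hy, rfl⟩
  rw [this, ncard_pair]
  intro h
  exact hyx (h ▸ mem_connectedComponentIn hy)

theorem IsPreconnected.union_of_closure {X : Type*} [TopologicalSpace X] {N K : Set X}
    (hN : IsPreconnected N) (hK : IsPreconnected K) (h : (closure N ∩ K).Nonempty) :
    IsPreconnected (N ∪ K) := by
  obtain ⟨p, hpN, hpK⟩ := h
  have : IsPreconnected (insert p N) :=
    hN.subset_closure (subset_insert p N) (insert_subset hpN subset_closure)
  rw [show N ∪ K = insert p N ∪ K by
    rw [insert_union, insert_eq_of_mem (show p ∈ N ∪ K from Or.inr hpK)]]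
  exact this.union p (mem_insert p N) hpK hK

theorem IsOpen.exists_mem_closure_notMem {X : Type*} [TopologicalSpace X] [PreconnectedSpace X]
    {N : Set X} (hN : IsOpen N) (hne : N.Nonempty) (hu : N ≠ univ) : ∃ p ∈ closure N, p ∉ N := by
  by_contra! h
  exact hu (IsClopen.eq_univ ⟨closure_subset_iff_isClosed.1 h, hN⟩ hne)

/-- The inversion `x ↦ x⁻¹` of the Riemann sphere, exchanging `0` and `∞`. -/
noncomputable def OnePoint.invFun (p : OnePoint ℂ) : OnePoint ℂ :=
  p.elim ((0 : ℂ) : OnePoint ℂ) fun x => if x = 0 then ∞ else ((x⁻¹ : ℂ) : OnePoint ℂ)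

theorem OnePoint.invFun_infty : OnePoint.invFun ∞ = ((0 : ℂ) : OnePoint ℂ) := rfl

theorem OnePoint.invFun_zero : OnePoint.invFun ((0 : ℂ) : OnePoint ℂ) = ∞ := if_pos rfl

theorem OnePoint.invFun_coe {x : ℂ} (hx : x ≠ 0) :
    OnePoint.invFun (x : OnePoint ℂ) = ((x⁻¹ : ℂ) : OnePoint ℂ) := if_neg hx

theorem OnePoint.invFun_invFun (p : OnePoint ℂ) : OnePoint.invFun (OnePoint.invFun p) = p := by
  induction p using OnePoint.rec with
  | infty => rw [invFun_infty, invFun_zero]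
  | coe x =>
    by_cases hx : x = 0
    · rw [hx, invFun_zero, invFun_infty]
    · rw [invFun_coe hx, invFun_coe (inv_ne_zero hx), inv_inv]

theorem OnePoint.continuous_invFun : Continuous OnePoint.invFun := by
  rw [continuous_iff_continuousAt]
  intro p
  induction p using OnePoint.rec with
  | infty =>
    rw [continuousAt_infty', invFun_infty, Filter.coclosedCompact_eq_cocompact,
      ← Metric.cobounded_eq_cocompact]
    refine ((continuous_coe.tendsto (0 : ℂ)).comp tendsto_inv₀_cobounded).congr' ?_
    filter_upwards [Bornology.eventually_ne_cobounded (0 : ℂ)] with x hx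
    rw [Function.comp_apply, Function.comp_apply, invFun_coe hx]
  | coe x =>
    rw [continuousAt_coe]
    by_cases hx : x = 0
    · subst hx
      rw [continuousAt_iff_punctured_nhds, Function.comp_apply, invFun_zero]
      have h := tendsto_inv₀_nhdsNE_zero (α := ℂ)
      rw [Metric.cobounded_eq_cocompact, ← Filter.coclosedCompact_eq_cocompact] at h
      refine (tendsto_coe_infty.comp h).congr' ?_
      filter_upwards [self_mem_nhdsWithin] with x hx
      rw [Function.comp_apply, Function.comp_apply, invFun_coe hx]
    · have : ContinuousAt (fun y : ℂ => ((y⁻¹ : ℂ) : OnePoint ℂ)) x :=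
        continuous_coe.continuousAt.comp (continuousAt_inv₀ hx)
      refine this.congr ?_
      filter_upwards [isOpen_ne.mem_nhds hx] with y hy
      rw [Function.comp_apply, invFun_coe hy]

/-- The inversion of the Riemann sphere as a homeomorphism. -/
noncomputable def OnePoint.invHomeo : OnePoint ℂ ≃ₜ OnePoint ℂ where
  toFun := OnePoint.invFun
  invFun := OnePoint.invFun
  left_inv := OnePoint.invFun_invFun
  right_inv := OnePoint.invFun_invFun
  continuous_toFun := OnePoint.continuous_invFun
  continuous_invFun := OnePoint.continuous_invFun

/-- The affine map `x ↦ c * x + d` of the Riemann sphere as a homeomorphism. -/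
noncomputable def OnePoint.affineHomeo (c d : ℂ) (hc : c ≠ 0) : OnePoint ℂ ≃ₜ OnePoint ℂ :=
  ((Homeomorph.mulLeft₀ c hc).trans (Homeomorph.addRight d)).onePointCongr

theorem OnePoint.affineHomeo_coe (c d : ℂ) (hc : c ≠ 0) (x : ℂ) :
    OnePoint.affineHomeo c d hc x = ((c * x + d : ℂ) : OnePoint ℂ) := rfl

theorem OnePoint.affineHomeo_infty (c d : ℂ) (hc : c ≠ 0) :
    OnePoint.affineHomeo c d hc ∞ = ∞ := rfl

/-- The map `x ↦ x ^ 2` of the Riemann sphere. -/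
noncomputable def OnePoint.sq : OnePoint ℂ → OnePoint ℂ := OnePoint.map fun x => x ^ 2

theorem OnePoint.continuous_sq : Continuous OnePoint.sq := by
  refine continuous_map (by fun_prop) ?_
  rw [Filter.coclosedCompact_eq_cocompact]
  refine tendsto_cocompact_of_tendsto_dist_comp_atTop 0 ?_
  have : Tendsto (fun x : ℂ => ‖x‖ ^ 2) (cocompact ℂ) atTop :=
    (tendsto_pow_atTop two_ne_zero).comp (tendsto_norm_cocompact_atTop)
  simpa using this

theorem OnePoint.sq_coe (x : ℂ) : OnePoint.sq x = ((x ^ 2 : ℂ) : OnePoint ℂ) := rfl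

/-- The map `x ↦ -x` of the Riemann sphere. -/
noncomputable def OnePoint.negHomeo : OnePoint ℂ ≃ₜ OnePoint ℂ := (Homeomorph.neg ℂ).onePointCongr

theorem OnePoint.negHomeo_coe (x : ℂ) : OnePoint.negHomeo x = ((-x : ℂ) : OnePoint ℂ) := rfl

theorem OnePoint.negHomeo_negHomeo (p : OnePoint ℂ) :
    OnePoint.negHomeo (OnePoint.negHomeo p) = p := by
  induction p using OnePoint.rec with
  | infty => rfl
  | coe x => rw [negHomeo_coe, negHomeo_coe, neg_neg]

theorem OnePoint.sq_negHomeo (p : OnePoint ℂ) :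
    OnePoint.sq (OnePoint.negHomeo p) = OnePoint.sq p := by
  induction p using OnePoint.rec with
  | infty => rfl
  | coe x => rw [negHomeo_coe, sq_coe, sq_coe, neg_sq]

theorem OnePoint.sq_eq_sq {p q : OnePoint ℂ} (h : OnePoint.sq p = OnePoint.sq q) :
    p = q ∨ p = OnePoint.negHomeo q := by
  induction p using OnePoint.rec with
  | infty =>
    induction q using OnePoint.rec with
    | infty => exact Or.inl rfl
    | coe y => exact absurd h (infty_ne_coe _)
  | coe x =>
    induction q using OnePoint.rec with
    | infty => exact absurd h (coe_ne_infty _)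
    | coe y =>
      rw [sq_coe, sq_coe, coe_eq_coe, sq_eq_sq_iff_eq_or_eq_neg] at h
      rw [negHomeo_coe, coe_eq_coe, coe_eq_coe]
      exact h

theorem OnePoint.surjective_sq : Function.Surjective OnePoint.sq := by
  intro p
  induction p using OnePoint.rec with
  | infty => exact ⟨∞, rfl⟩
  | coe x =>
    obtain ⟨y, hy⟩ := IsAlgClosed.exists_pow_nat_eq x two_pos
    exact ⟨y, by rw [sq_coe, hy]⟩

theorem isPreconnected_preimage_sq {E : Set (OnePoint ℂ)} (hE : IsClosed E)
    (hc : IsPreconnected E) (h0 : ((0 : ℂ) : OnePoint ℂ) ∈ E) :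
    IsPreconnected (OnePoint.sq ⁻¹' E) := by
  set S := OnePoint.sq ⁻¹' E with hS
  have hScl : IsClosed S := hE.preimage continuous_sq
  have key : ∀ s t : Set (OnePoint ℂ), IsClosed s → IsClosed t → S ⊆ s ∪ t →
      ((0 : ℂ) : OnePoint ℂ) ∈ s → (S ∩ t).Nonempty → (S ∩ (s ∩ t)).Nonempty := by
    intro s t hs ht hst h0s hSt
    by_contra! hem
    have hdis : ∀ p ∈ S, p ∈ s → p ∉ t := fun p hp hps hpt =>
      (hem.subset (⟨hp, hps, hpt⟩ : p ∈ S ∩ (s ∩ t))).elim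
    have hSn : ∀ p ∈ S, negHomeo p ∈ S := fun p hp => by
      rwa [hS, mem_preimage, sq_negHomeo]
    set A := S ∩ (s ∩ negHomeo ⁻¹' s)
    set B := S ∩ (t ∪ negHomeo ⁻¹' t)
    have hA : IsClosed (sq '' A) := (hScl.inter (hs.inter
      (hs.preimage negHomeo.continuous))).isCompact.image continuous_sq |>.isClosed
    have hB : IsClosed (sq '' B) := (hScl.inter (ht.union
      (ht.preimage negHomeo.continuous))).isCompact.image continuous_sq |>.isClosed
    obtain ⟨b, hbS, hbt⟩ := hSt
    obtain ⟨y, hyE, ⟨p, hp, hpy⟩, ⟨q, hq, hqy⟩⟩ := isPreconnected_closed_iff.1 hc _ _ hA hB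
      (fun y hy => by
        obtain ⟨p, rfl⟩ := surjective_sq y
        by_cases hpA : p ∈ A
        · exact Or.inl ⟨p, hpA, rfl⟩
        · refine Or.inr ⟨p, ⟨hy, ?_⟩, rfl⟩
          by_contra hn
          rw [mem_union, not_or] at hn
          exact hpA ⟨hy, (hst hy).resolve_right hn.1,
            (hst (hSn p hy)).resolve_right hn.2⟩)
      ⟨_, h0, ((0 : ℂ) : OnePoint ℂ), ⟨by rw [hS, mem_preimage, sq_coe]; simpa using h0, h0s, by
        rw [mem_preimage, negHomeo_coe, neg_zero]; exact h0s⟩, by rw [sq_coe]; simp⟩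
      ⟨_, hbS, b, ⟨hbS, Or.inl hbt⟩, rfl⟩
    have hqA : q ∈ A := by
      rcases sq_eq_sq (hqy.trans hpy.symm) with rfl | rfl
      · exact hp
      · exact ⟨hSn _ hp.1, hp.2.2, by rw [mem_preimage, negHomeo_negHomeo]; exact hp.2.1⟩
    rcases hq.2 with h | h
    · exact hdis q hq.1 hqA.2.1 h
    · exact hdis _ (hSn q hq.1) hqA.2.2 h
  have h0S : ((0 : ℂ) : OnePoint ℂ) ∈ S := by rw [hS, mem_preimage, sq_coe]; simpa using h0
  rw [isPreconnected_closed_iff]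
  intro s t hs ht hst hSs hSt
  rcases hst h0S with h | h
  · exact key s t hs ht hst h hSt
  · rw [inter_comm s t]
    exact key t s ht hs (by rwa [union_comm]) h hSs

/-- Injective holomorphic maps on `D` whose image has connected complement in the sphere. -/
structure FullUnivalent (D : Set ℂ) (f : ℂ → ℂ) : Prop where
  diff : DifferentiableOn ℂ f D
  inj : InjOn f D
  compl : IsPreconnected (((↑) : ℂ → OnePoint ℂ) '' (f '' D))ᶜ

theorem isOpen_image_of_injOn {D : Set ℂ} {f : ℂ → ℂ} (hD : IsOpen D) (hc : IsConnected D)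
    (hf : DifferentiableOn ℂ f D) (hi : InjOn f D) {s : Set ℂ} (hs : s ⊆ D) (hso : IsOpen s) :
    IsOpen (f '' s) := by
  rcases (hf.analyticOnNhd hD).is_constant_or_isOpen hc.isPreconnected with ⟨w, hw⟩ | h
  · obtain ⟨x, hx⟩ := hc.nonempty
    have : D ⊆ {x} := fun y hy => hi hy hx ((hw y hy).trans (hw x hx).symm)
    exact absurd ((finite_singleton x).subset this) (infinite_of_mem_nhds x (hD.mem_nhds hx))
  · exact h s hs hso

theorem HasLogSub.exists_differentiableOn {U : Set ℂ} (hU : IsOpen U) {p : ℂ}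
    (h : HasLogSub U p) :
    ∃ g, DifferentiableOn ℂ g U ∧ ∀ x ∈ U, Complex.exp (g x) = x - p := by
  obtain ⟨g, hg, he⟩ := h
  refine ⟨g, fun x hx => ?_, he⟩
  have h1 : HasStrictDerivAt (fun z => Complex.exp z + p) (Complex.exp (g x)) (g x) :=
    (Complex.hasStrictDerivAt_exp (g x)).add_const p
  refine (h1.of_local_left_inverse (hg.continuousAt (hU.mem_nhds hx)) (Complex.exp_ne_zero _)
    ?_).hasDerivAt.differentiableAt.differentiableWithinAt
  filter_upwards [hU.mem_nhds hx] with y hy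
  rw [he y hy, sub_add_cancel]

theorem FullUnivalent.of_homeo {D : Set ℂ} {f f' : ℂ → ℂ} (hf : FullUnivalent D f)
    (e : OnePoint ℂ ≃ₜ OnePoint ℂ) (he : ∀ x ∈ D, e (f x) = f' x)
    (hd : DifferentiableOn ℂ f' D) : FullUnivalent D f' := by
  refine ⟨hd, fun x hx y hy hxy => ?_, ?_⟩
  · refine hf.inj hx hy (coe_injective (e.injective ?_))
    rw [he x hx, he y hy, hxy]
  · have : ((↑) : ℂ → OnePoint ℂ) '' (f' '' D) = e '' ((↑) '' (f '' D)) := by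
      rw [image_image, image_image, image_image]
      exact image_congr fun x hx => (he x hx).symm
    rw [this, ← image_compl_eq e.bijective]
    exact hf.compl.image _ e.continuous.continuousOn

theorem FullUnivalent.affine {D : Set ℂ} {f : ℂ → ℂ} (hf : FullUnivalent D f) {c : ℂ}
    (hc : c ≠ 0) (d : ℂ) :
    FullUnivalent D fun x => c * f x + d :=
  hf.of_homeo (affineHomeo c d hc) (fun x _ => affineHomeo_coe c d hc (f x))
    ((hf.diff.const_mul c).add_const d)

theorem FullUnivalent.inv {D : Set ℂ} {f : ℂ → ℂ} (hf : FullUnivalent D f)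
    (h0 : ∀ x ∈ D, f x ≠ 0) :
    FullUnivalent D fun x => (f x)⁻¹ :=
  hf.of_homeo invHomeo (fun x hx => invFun_coe (h0 x hx)) (hf.diff.inv h0)

theorem FullUnivalent.sqrt {D : Set ℂ} (hD : IsOpen D) (hDc : IsConnected D) {f : ℂ → ℂ}
    (hf : FullUnivalent D f)
    (h0 : ∀ x ∈ D, f x ≠ 0) :
    ∃ h, FullUnivalent D h ∧ (∀ x ∈ D, h x ^ 2 = f x) ∧ ∀ x ∈ D, ∀ y ∈ D, h x ≠ -h y := by
  set E : Set (OnePoint ℂ) := (((↑) : ℂ → OnePoint ℂ) '' (f '' D))ᶜ with hE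
  have hfo : IsOpen (f '' D) := isOpen_image_of_injOn hD hDc hf.diff hf.inj subset_rfl hD
  have hEcl : IsClosed E := (isOpen_image_coe.2 hfo).isClosed_compl
  have hE0 : ((0 : ℂ) : OnePoint ℂ) ∈ E := by
    rintro ⟨_, ⟨x, hx, rfl⟩, h⟩
    exact h0 x hx (coe_injective h)
  obtain ⟨g, hg, he⟩ := (hasLogSub_of_isPreconnected hfo (hDc.image f hf.diff.continuousOn) hf.compl
    infty_notMem_image_coe hE0 fun y hy h => h ⟨y, hy, rfl⟩).exists_differentiableOn hfo
  set h : ℂ → ℂ := fun x => Complex.exp (g (f x) / 2) with hh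
  have hsq : ∀ x ∈ D, h x ^ 2 = f x := fun x hx => by
    refine Eq.trans ?_ ((he _ ⟨x, hx, rfl⟩).trans (sub_zero _))
    rw [hh, ← Complex.exp_nat_mul]
    congr 1
    push_cast
    ring
  have hne : ∀ x ∈ D, ∀ y ∈ D, h x ≠ -h y := fun x hx y hy hxy => by
    have h1 : f x = f y := by rw [← hsq x hx, ← hsq y hy, hxy, neg_sq]
    have h2 : h x = h y := by simp only [hh, h1]
    exact Complex.exp_ne_zero (g (f x) / 2) (by
      change h x = 0
      linear_combination (hxy + h2) / 2)
  have hdiff : DifferentiableOn ℂ h D :=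
    ((hg.comp hf.diff (mapsTo_image f D)).div_const 2).cexp
  have hinj : InjOn h D := fun x hx y hy hxy =>
    hf.inj hx hy (by rw [← hsq x hx, ← hsq y hy, hxy])
  refine ⟨h, ⟨hdiff, hinj, ?_⟩, hsq, hne⟩
  set H : Set (OnePoint ℂ) := ((↑) : ℂ → OnePoint ℂ) '' (h '' D) with hH
  have hHo : IsOpen H := isOpen_image_coe.2 (isOpen_image_of_injOn hD hDc hdiff hinj subset_rfl hD)
  have hHc : IsConnected H := (hDc.image h hdiff.continuousOn).image _ continuous_coe.continuousOn
  set N := negHomeo '' H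
  have hNo : IsOpen N := negHomeo.isOpenMap _ hHo
  have hNc : IsConnected N := hHc.image _ negHomeo.continuous.continuousOn
  have hNH : Disjoint N H := by
    rw [disjoint_left]
    rintro _ ⟨_, ⟨_, ⟨x, hx, rfl⟩, rfl⟩, rfl⟩ ⟨_, ⟨y, hy, rfl⟩, hxy⟩
    exact hne y hy x hx (coe_injective hxy)
  have hcompl : Hᶜ = N ∪ OnePoint.sq ⁻¹' E := by
    ext p
    constructor
    · intro hp
      by_cases hpE : OnePoint.sq p ∈ E
      · exact Or.inr hpE
      · obtain ⟨_, ⟨x, hx, rfl⟩, hxp⟩ := not_not.1 hpE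
        rw [← hsq x hx, ← sq_coe] at hxp
        rcases sq_eq_sq hxp.symm with rfl | rfl
        · exact absurd ⟨_, ⟨x, hx, rfl⟩, rfl⟩ hp
        · exact Or.inl ⟨_, ⟨_, ⟨x, hx, rfl⟩, rfl⟩, rfl⟩
    · rintro (hp | hp) hpH
      · exact hNH.notMem_of_mem_left hp hpH
      · obtain ⟨_, ⟨x, hx, rfl⟩, rfl⟩ := hpH
        rw [mem_preimage, sq_coe, hsq x hx] at hp
        exact hp ⟨_, ⟨x, hx, rfl⟩, rfl⟩
  obtain ⟨p, hp, hpN⟩ := hNo.exists_mem_closure_notMem hNc.nonempty fun hu => by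
    obtain ⟨q, hq⟩ := hHc.nonempty
    exact hNH.notMem_of_mem_right hq (hu ▸ mem_univ q)
  have hpH : p ∈ Hᶜ := fun h => by
    exact (hNH.closure_left hHo).notMem_of_mem_left hp h
  rw [hcompl] at hpH ⊢
  exact hNc.isPreconnected.union_of_closure (isPreconnected_preimage_sq hEcl hf.compl hE0)
    ⟨p, hp, hpH.resolve_left hpN⟩

/-- The automorphism of the unit disc sending `a` to `0`. -/
noncomputable def blaschke (a x : ℂ) : ℂ := (x - a) / (1 - conj a * x)

theorem one_sub_conj_mul_ne_zero {a x : ℂ} (ha : ‖a‖ < 1) (hx : ‖x‖ < 1) :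
    1 - conj a * x ≠ 0 := by
  intro h
  have h1 : ‖conj a * x‖ = 1 := by rw [← sub_eq_zero.1 h, norm_one]
  rw [norm_mul, Complex.norm_conj] at h1
  nlinarith [norm_nonneg a, norm_nonneg x]

theorem norm_one_sub_conj_mul_sq (a x : ℂ) :
    ‖1 - conj a * x‖ ^ 2 - ‖x - a‖ ^ 2 = (1 - ‖a‖ ^ 2) * (1 - ‖x‖ ^ 2) := by
  simp only [Complex.sq_norm, Complex.normSq_apply, Complex.sub_re, Complex.sub_im, Complex.mul_re,
    Complex.mul_im, Complex.conj_re, Complex.conj_im, Complex.one_re, Complex.one_im]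
  ring

theorem one_sub_norm_blaschke_sq {a x : ℂ} (ha : ‖a‖ < 1) (hx : ‖x‖ < 1) :
    (1 - ‖blaschke a x‖ ^ 2) * ‖1 - conj a * x‖ ^ 2 = (1 - ‖a‖ ^ 2) * (1 - ‖x‖ ^ 2) := by
  have h := norm_ne_zero_iff.2 (one_sub_conj_mul_ne_zero ha hx)
  rw [← norm_one_sub_conj_mul_sq, blaschke, norm_div, div_pow, sub_mul, one_mul,
    div_mul_cancel₀ _ (pow_ne_zero 2 h)]

theorem norm_blaschke_lt_one {a x : ℂ} (ha : ‖a‖ < 1) (hx : ‖x‖ < 1) : ‖blaschke a x‖ < 1 := by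
  rw [blaschke, norm_div, div_lt_one (norm_pos_iff.2 (one_sub_conj_mul_ne_zero ha hx))]
  have h := norm_one_sub_conj_mul_sq a x
  have : 0 < (1 - ‖a‖ ^ 2) * (1 - ‖x‖ ^ 2) :=
    mul_pos (by nlinarith [norm_nonneg a]) (by nlinarith [norm_nonneg x])
  exact lt_of_pow_lt_pow_left₀ 2 (norm_nonneg _) (by linarith)

theorem blaschke_self (a : ℂ) : blaschke a a = 0 := by simp [blaschke]

theorem blaschke_zero_right (a : ℂ) : blaschke a 0 = -a := by simp [blaschke]

theorem blaschke_ne_zero {a x : ℂ} (ha : ‖a‖ < 1) (hx : ‖x‖ < 1) (h : x ≠ a) :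
    blaschke a x ≠ 0 :=
  div_ne_zero (sub_ne_zero.2 h) (one_sub_conj_mul_ne_zero ha hx)

theorem hasDerivAt_blaschke {a x : ℂ} (ha : ‖a‖ < 1) (hx : ‖x‖ < 1) :
    HasDerivAt (blaschke a) ((1 - (‖a‖ : ℂ) ^ 2) / (1 - conj a * x) ^ 2) x := by
  have h := one_sub_conj_mul_ne_zero ha hx
  refine (((hasDerivAt_id x).sub_const a).div
    (((hasDerivAt_id x).const_mul (conj a)).const_sub 1) h).congr_deriv ?_
  rw [← Complex.mul_conj']
  simp only [id]
  ring

theorem DifferentiableOn.blaschke {D : Set ℂ} {f : ℂ → ℂ} (hf : DifferentiableOn ℂ f D)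
    (h1 : ∀ x ∈ D, ‖f x‖ < 1) {a : ℂ} (ha : ‖a‖ < 1) :
    DifferentiableOn ℂ (fun x => blaschke a (f x)) D := fun x hx =>
  (hasDerivAt_blaschke ha (h1 x hx)).differentiableAt.comp_differentiableWithinAt x (hf x hx)

theorem FullUnivalent.blaschke {D : Set ℂ} {f : ℂ → ℂ} (hf : FullUnivalent D f)
    (h1 : ∀ x ∈ D, ‖f x‖ < 1)
    {a : ℂ} (ha : ‖a‖ < 1) : FullUnivalent D fun x => blaschke a (f x) := by
  by_cases h0 : a = 0
  · simpa [_root_.blaschke, h0] using hf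
  have hc : conj a ≠ 0 := by simpa using h0
  have hd : ∀ x ∈ D, -conj a * f x + 1 ≠ 0 := fun x hx => by
    have := one_sub_conj_mul_ne_zero ha (h1 x hx)
    rwa [neg_mul, neg_add_eq_sub]
  have hk : (conj a)⁻¹ - a ≠ 0 := by
    intro h
    have h2 := one_sub_conj_mul_ne_zero ha ha
    refine h2 ?_
    linear_combination conj a * h - mul_inv_cancel₀ hc
  have := ((hf.affine (neg_ne_zero.2 hc) 1).inv hd).affine hk (-(conj a)⁻¹)
  refine ⟨hf.diff.blaschke h1 ha, ?_, ?_⟩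
  all_goals
    have he : ∀ x ∈ D, ((conj a)⁻¹ - a) * (-conj a * f x + 1)⁻¹ + -(conj a)⁻¹ =
        _root_.blaschke a (f x) := fun x hx => by
      have h3 := hd x hx
      have h4 := one_sub_conj_mul_ne_zero ha (h1 x hx)
      rw [_root_.blaschke, show 1 - conj a * f x = -conj a * f x + 1 by ring]
      rw [eq_div_iff h3]
      linear_combination ((conj a)⁻¹ - a) * inv_mul_cancel₀ h3 + f x * inv_mul_cancel₀ hc
  · exact this.inj.congr he
  · rw [← image_congr he]
    exact this.compl

/-- Full univalent maps into the unit disc vanishing at `x₀`. -/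
structure DiscMap (D : Set ℂ) (x₀ : ℂ) (f : ℂ → ℂ) : Prop extends FullUnivalent D f where
  norm_lt : ∀ x ∈ D, ‖f x‖ < 1
  zero : f x₀ = 0

theorem DiscMap.exists_norm_deriv_ge {D : Set ℂ} (hD : IsOpen D) (hDc : IsConnected D) {x₀ : ℂ}
    (hx₀ : x₀ ∈ D) {f : ℂ → ℂ} (hf : DiscMap D x₀ f) {σ : ℝ} (hσ1 : σ < 1) (hσ0 : 0 < σ) {a : ℂ}
    (ha : ‖a‖ < σ ^ 2) (haf : a ∉ f '' D) :
    ∃ g, DiscMap D x₀ g ∧ ‖deriv f x₀‖ * ((1 + σ ^ 2) / (2 * σ)) ≤ ‖deriv g x₀‖ := by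
  have ha1 : ‖a‖ < 1 := by nlinarith
  have hDx := hD.mem_nhds hx₀
  obtain ⟨h, hh, hsq, -⟩ := (hf.toFullUnivalent.blaschke hf.norm_lt ha1).sqrt hD hDc fun x hx =>
    blaschke_ne_zero ha1 (hf.norm_lt x hx) fun h => haf ⟨x, hx, h⟩
  have hh1 : ∀ x ∈ D, ‖h x‖ < 1 := fun x hx => by
    have := norm_blaschke_lt_one ha1 (hf.norm_lt x hx)
    rw [← hsq x hx, norm_pow] at this
    exact (pow_lt_one_iff_of_nonneg (norm_nonneg _) two_ne_zero).1 this
  set b := h x₀ with hb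
  have hb1 : ‖b‖ < 1 := hh1 x₀ hx₀
  have hba : b ^ 2 = -a := by rw [hb, hsq x₀ hx₀, hf.zero, blaschke_zero_right]
  have hban : ‖b‖ ^ 2 = ‖a‖ := by rw [← norm_pow, hba, norm_neg]
  have hb0 : 0 < ‖b‖ := by
    refine norm_pos_iff.2 fun h0 => haf ⟨x₀, hx₀, ?_⟩
    rw [h0] at hba
    rw [hf.zero]
    linear_combination -hba
  have hbσ : ‖b‖ < σ := lt_of_pow_lt_pow_left₀ 2 hσ0.le (by rwa [hban])
  refine ⟨fun x => blaschke b (h x), ⟨hh.blaschke hh1 hb1, fun x hx =>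
    norm_blaschke_lt_one hb1 (hh1 x hx), blaschke_self b⟩, ?_⟩
  have hdf : HasDerivAt f (deriv f x₀) x₀ := (hf.diff.differentiableAt hDx).hasDerivAt
  have hdh : HasDerivAt h (deriv h x₀) x₀ := (hh.diff.differentiableAt hDx).hasDerivAt
  have hd1 : HasDerivAt (fun x => blaschke a (f x)) ((1 - (‖a‖ : ℂ) ^ 2) * deriv f x₀) x₀ := by
    have := (hasDerivAt_blaschke ha1 (hf.norm_lt x₀ hx₀)).comp x₀ hdf
    refine this.congr_deriv ?_
    simp [hf.zero]
  have hd2 : HasDerivAt (fun x => blaschke a (f x)) (2 * b * deriv h x₀) x₀ := by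
    refine ((hdh.pow 2).congr_deriv ?_).congr_of_eventuallyEq ?_
    · simp [hb]
    · filter_upwards [hDx] with x hx
      exact (hsq x hx).symm
  have hd3 : HasDerivAt (fun x => blaschke b (h x))
      ((1 - (‖b‖ : ℂ) ^ 2) / (1 - conj b * b) ^ 2 * deriv h x₀) x₀ :=
    (hasDerivAt_blaschke hb1 hb1).comp x₀ hdh
  have e := congrArg norm (hd1.unique hd2)
  rw [hd3.deriv]
  rw [Complex.conj_mul', norm_mul, norm_div, norm_pow]
  have n1 : ∀ r : ℝ, 0 ≤ r → r < 1 → ‖(1 - (r : ℂ) ^ 2)‖ = 1 - r ^ 2 := fun r h0 h1 => by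
    rw [← Complex.ofReal_pow, ← Complex.ofReal_one, ← Complex.ofReal_sub, Complex.norm_real,
      Real.norm_of_nonneg (by nlinarith)]
  rw [norm_mul, norm_mul, norm_mul, n1 _ (norm_nonneg a) ha1, Complex.norm_ofNat] at e
  rw [n1 _ (norm_nonneg b) hb1]
  generalize ‖deriv h x₀‖ = H at *
  generalize hP : ‖deriv f x₀‖ = P at *
  have hP0 : 0 ≤ P := hP ▸ norm_nonneg _
  rw [← hban] at e
  generalize ‖b‖ = s at *
  have hs2 : 0 < 1 - s ^ 2 := by nlinarith
  have hH : H = (1 - (s ^ 2) ^ 2) * P / (2 * s) := by field_simp; linarith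
  have : (1 - s ^ 2) / (1 - s ^ 2) ^ 2 * H = P * ((1 + s ^ 2) / (2 * s)) := by
    rw [hH]; field_simp; ring
  rw [this]
  refine mul_le_mul_of_nonneg_left ?_ hP0
  rw [div_le_div_iff₀ (by positivity) (by positivity)]
  nlinarith [mul_pos (sub_pos.2 hbσ) (show 0 < 1 - s * σ by nlinarith)]

theorem norm_sq_le_of_norm_blaschke_le {a x : ℂ} (ha : ‖a‖ < 1) (hx : ‖x‖ < 1)
    (h : ‖blaschke a x‖ ≤ 1 / 2) {ρ : ℝ} (hρ : ρ < 1) (haρ : ‖a‖ ≤ ρ ∨ ‖x‖ ≤ ρ) :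
    ‖a‖ ≤ √(1 - 3 / 4 * (1 - ρ) ^ 2) ∧ ‖x‖ ≤ √(1 - 3 / 4 * (1 - ρ) ^ 2) := by
  have e := one_sub_norm_blaschke_sq ha hx
  have h1 : 1 - ‖a‖ * ‖x‖ ≤ ‖1 - conj a * x‖ := by
    have := norm_sub_norm_le (1 : ℂ) (conj a * x)
    rwa [norm_one, norm_mul, Complex.norm_conj] at this
  have hb : 3 / 4 ≤ 1 - ‖blaschke a x‖ ^ 2 := by nlinarith [norm_nonneg (blaschke a x)]
  have hax : 0 < 1 - ‖a‖ * ‖x‖ := by nlinarith [norm_nonneg a, norm_nonneg x]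
  have h2 : 3 / 4 * (1 - ‖a‖ * ‖x‖) ^ 2 ≤ (1 - ‖a‖ ^ 2) * (1 - ‖x‖ ^ 2) := by
    rw [← e]
    gcongr
  have hna := norm_nonneg a
  have hnx := norm_nonneg x
  generalize ‖a‖ = s at *
  generalize ‖x‖ = t at *
  have hρ' : (1 - ρ) ^ 2 ≤ (1 - s * t) ^ 2 := by
    have : s * t ≤ ρ := by
      rcases haρ with h | h <;> nlinarith
    nlinarith
  have hs : 1 - s ^ 2 ≤ 1 := by nlinarith
  have ht : 1 - t ^ 2 ≤ 1 := by nlinarith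
  have hs0 : 0 ≤ 1 - s ^ 2 := by nlinarith
  have ht0 : 0 ≤ 1 - t ^ 2 := by nlinarith
  constructor
  · refine Real.le_sqrt_of_sq_le ?_
    nlinarith
  · refine Real.le_sqrt_of_sq_le ?_
    nlinarith

theorem sqrt_one_sub_lt_one {ρ : ℝ} (hρ : ρ < 1) : √(1 - 3 / 4 * (1 - ρ) ^ 2) < 1 := by
  rw [Real.sqrt_lt' one_pos]
  nlinarith [pow_pos (sub_pos.2 hρ) 2]

theorem norm_blaschke_le_half {f : ℂ → ℂ} {a : ℂ} {R : ℝ}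
    (hf : DifferentiableOn ℂ f (ball a R)) (h1 : ∀ x ∈ ball a R, ‖f x‖ < 1) {x : ℂ}
    (hx : x ∈ ball a (R / 2)) : ‖blaschke (f a) (f x)‖ ≤ 1 / 2 := by
  have hR2 : 0 < R / 2 := pos_of_mem_ball hx
  have hR : 0 < R := by linarith
  have ha : ‖f a‖ < 1 := h1 a (mem_ball_self hR)
  have := Complex.dist_le_div_mul_dist_of_mapsTo_ball (R₂ := 1) (hf.blaschke h1 ha)
    (fun y hy => by
      rw [blaschke_self, mem_closedBall_zero_iff]
      exact (norm_blaschke_lt_one ha (h1 y hy)).le) (ball_subset_ball (by linarith) hx)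
  rw [blaschke_self, dist_zero_right] at this
  refine this.trans ?_
  rw [one_div_mul_eq_div, div_le_div_iff₀ hR two_pos]
  linarith [mem_ball.1 hx]

theorem eventually_forall_norm_le {D : Set ℂ} (hD : IsOpen D) {a : ℂ} (ha : a ∈ D) :
    ∀ᶠ x in 𝓝 a, ∀ ρ < (1 : ℝ), ∀ f : ℂ → ℂ, DifferentiableOn ℂ f D → (∀ x ∈ D, ‖f x‖ < 1) →
      (‖f a‖ ≤ ρ ∨ ‖f x‖ ≤ ρ) →
      ‖f a‖ ≤ √(1 - 3 / 4 * (1 - ρ) ^ 2) ∧ ‖f x‖ ≤ √(1 - 3 / 4 * (1 - ρ) ^ 2) := by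
  obtain ⟨R, hR, hb⟩ := Metric.isOpen_iff.1 hD a ha
  filter_upwards [ball_mem_nhds a (half_pos hR)] with x hx ρ hρ f hf h1 h
  exact norm_sq_le_of_norm_blaschke_le (h1 a ha) (h1 x (hb (ball_subset_ball (by linarith) hx)))
    (norm_blaschke_le_half (hf.mono hb) (fun y hy => h1 y (hb hy)) hx) hρ h

theorem exists_forall_norm_le {D : Set ℂ} (hD : IsOpen D) (hDc : IsPreconnected D) {x₀ : ℂ}
    (hx₀ : x₀ ∈ D) {L : Set ℂ} (hL : IsCompact L) (hLD : L ⊆ D) :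
    ∃ ρ < (1 : ℝ), ∀ f : ℂ → ℂ, DifferentiableOn ℂ f D → (∀ x ∈ D, ‖f x‖ < 1) → f x₀ = 0 →
      ∀ x ∈ L, ‖f x‖ ≤ ρ := by
  have key : ∀ x ∈ D, ∃ ρ < (1 : ℝ), ∀ f : ℂ → ℂ, DifferentiableOn ℂ f D →
      (∀ x ∈ D, ‖f x‖ < 1) → f x₀ = 0 →
      ‖f x‖ ≤ ρ := by
    intro x hx
    obtain ⟨ρ, hρ, h⟩ := hDc.induction₂' (fun x y => ∀ ρ < (1 : ℝ), ∃ ρ' < (1 : ℝ), ∀ f : ℂ → ℂ,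
      DifferentiableOn ℂ f D → (∀ x ∈ D, ‖f x‖ < 1) → ‖f x‖ ≤ ρ → ‖f y‖ ≤ ρ')
      (fun x hx => by
        filter_upwards [mem_nhdsWithin_of_mem_nhds (eventually_forall_norm_le hD hx)] with y hy
        exact ⟨fun ρ hρ => ⟨_, sqrt_one_sub_lt_one hρ,
            fun f h1 h2 h => (hy ρ hρ f h1 h2 (Or.inl h)).2⟩,
          fun ρ hρ => ⟨_, sqrt_one_sub_lt_one hρ,
            fun f h1 h2 h => (hy ρ hρ f h1 h2 (Or.inr h)).1⟩⟩)
      (fun x y z _ _ _ hxy hyz ρ hρ => by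
        obtain ⟨ρ', hρ', h⟩ := hxy ρ hρ
        obtain ⟨ρ'', hρ'', h'⟩ := hyz ρ' hρ'
        exact ⟨ρ'', hρ'', fun f h1 h2 h3 => h' f h1 h2 (h f h1 h2 h3)⟩) hx₀ hx 0 one_pos
    exact ⟨ρ, hρ, fun f h1 h2 h3 => h f h1 h2 (by simp [h3])⟩
  refine hL.induction_on (p := fun s => ∃ ρ < (1 : ℝ), ∀ f : ℂ → ℂ,
    DifferentiableOn ℂ f D → (∀ x ∈ D, ‖f x‖ < 1) →
    f x₀ = 0 → ∀ x ∈ s, ‖f x‖ ≤ ρ) ⟨0, one_pos, by simp⟩ ?_ ?_ ?_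
  · rintro s t hst ⟨ρ, hρ, h⟩
    exact ⟨ρ, hρ, fun f h1 h2 h3 x hx => h f h1 h2 h3 x (hst hx)⟩
  · rintro s t ⟨ρ, hρ, h⟩ ⟨ρ', hρ', h'⟩
    refine ⟨max ρ ρ', max_lt hρ hρ', ?_⟩
    rintro f h1 h2 h3 x (hx | hx)
    · exact (h f h1 h2 h3 x hx).trans (le_max_left _ _)
    · exact (h' f h1 h2 h3 x hx).trans (le_max_right _ _)
  · intro x hx
    obtain ⟨ρ, hρ, h⟩ := key x (hLD hx)
    exact ⟨_, mem_nhdsWithin_of_mem_nhds (eventually_forall_norm_le hD (hLD hx)), _,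
      sqrt_one_sub_lt_one hρ, fun f h1 h2 h3 y hy => (hy ρ hρ f h1 h2 (Or.inl (h f h1 h2 h3))).2⟩

theorem simplyConnectedSpace_of_forall_isCompact {X : Type*} [TopologicalSpace X]
    [PathConnectedSpace X]
    (h : ∀ L : Set X, IsCompact L → ∃ S, L ⊆ S ∧ IsSimplyConnected S) :
    SimplyConnectedSpace X := by
  refine simply_connected_iff_loops_nullhomotopic.2 ⟨inferInstance, fun x γ => ?_⟩
  obtain ⟨S, hLS, hS⟩ := h (range γ) (isCompact_range γ.continuous)
  obtain ⟨F, -⟩ := (isSimplyConnected_iff_exists_homotopy_refl_forall_mem.1 hS).2 x γ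
    fun t => hLS ⟨t, rfl⟩
  exact ⟨F⟩

theorem exists_discMap_deriv_ne_zero {D : Set ℂ} (hD : IsOpen D) (hDc : IsConnected D)
    (h0 : (0 : ℂ) ∉ D) (hc : IsPreconnected (((↑) : ℂ → OnePoint ℂ) '' D)ᶜ) {x₀ : ℂ}
    (hx₀ : x₀ ∈ D) : ∃ f, DiscMap D x₀ f ∧ deriv f x₀ ≠ 0 := by
  have hid : FullUnivalent D id := ⟨differentiableOn_id, injOn_id D, by rwa [image_id]⟩
  obtain ⟨h, hh, hsq, hne⟩ := hid.sqrt hD hDc fun x hx hx0 => h0 (hx0 ▸ hx)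
  have ho : IsOpen (h '' D) := isOpen_image_of_injOn hD hDc hh.diff hh.inj subset_rfl hD
  obtain ⟨δ, hδ, hb⟩ := Metric.isOpen_iff.1 ho (h x₀) ⟨x₀, hx₀, rfl⟩
  have hge : ∀ x ∈ D, δ ≤ ‖h x + h x₀‖ := by
    intro x hx
    by_contra! hlt
    obtain ⟨y, hy, hyx⟩ : -h x ∈ h '' D := hb <| by
      rw [mem_ball, dist_eq_norm, ← norm_neg]
      rwa [neg_sub, sub_neg_eq_add, add_comm]
    exact hne y hy x hx hyx
  have hne0 : ∀ x ∈ D, 1 * h x + h x₀ ≠ 0 := fun x hx => by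
    rw [one_mul]
    exact norm_pos_iff.1 (hδ.trans_le (hge x hx))
  have hle : ∀ x ∈ D, ‖(1 * h x + h x₀)⁻¹‖ ≤ δ⁻¹ := fun x hx => by
    rw [one_mul, norm_inv]
    exact inv_anti₀ hδ (hge x hx)
  have hδ3 : ((δ / 3 : ℝ) : ℂ) ≠ 0 := by
    rw [Ne, Complex.ofReal_eq_zero]
    positivity
  refine ⟨_, ⟨((hh.affine one_ne_zero (h x₀)).inv hne0).affine hδ3
    (-((δ / 3 : ℝ) * (1 * h x₀ + h x₀)⁻¹)), fun x hx => ?_, by simp⟩, ?_⟩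
  · rw [← sub_eq_add_neg, ← mul_sub, norm_mul, Complex.norm_real,
      Real.norm_of_nonneg (by positivity)]
    have : ‖(1 * h x + h x₀)⁻¹ - (1 * h x₀ + h x₀)⁻¹‖ ≤ δ⁻¹ + δ⁻¹ :=
      (norm_sub_le _ _).trans (add_le_add (hle x hx) (hle x₀ hx₀))
    calc δ / 3 * ‖(1 * h x + h x₀)⁻¹ - (1 * h x₀ + h x₀)⁻¹‖ ≤ δ / 3 * (δ⁻¹ + δ⁻¹) := by gcongr
      _ = 2 / 3 := by field_simp; norm_num
      _ < 1 := by norm_num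
  · have hdh : HasDerivAt h (deriv h x₀) x₀ :=
      (hh.diff.differentiableAt (hD.mem_nhds hx₀)).hasDerivAt
    have h1 : HasDerivAt (fun x : ℂ => x) (2 * h x₀ * deriv h x₀) x₀ := by
      refine ((hdh.pow 2).congr_deriv (by simp)).congr_of_eventuallyEq ?_
      filter_upwards [hD.mem_nhds hx₀] with x hx
      exact (hsq x hx).symm
    have h2 : deriv h x₀ ≠ 0 := by
      intro hz
      have := h1.unique (hasDerivAt_id' x₀)
      rw [hz, mul_zero] at this
      exact zero_ne_one this
    have h3 := ((((hdh.const_mul 1).add_const (h x₀)).inv (hne0 x₀ hx₀)).const_mul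
      ((δ / 3 : ℝ) : ℂ)).add_const (-((δ / 3 : ℝ) * (1 * h x₀ + h x₀)⁻¹))
    simp only [Pi.inv_apply] at h3
    rw [h3.deriv]
    refine mul_ne_zero hδ3 (div_ne_zero ?_ (pow_ne_zero 2 (hne0 x₀ hx₀)))
    rwa [one_mul, neg_ne_zero]

theorem exists_discMap_ball_subset {D : Set ℂ} (hD : IsOpen D) (hDc : IsConnected D)
    (h0 : (0 : ℂ) ∉ D) (hc : IsPreconnected (((↑) : ℂ → OnePoint ℂ) '' D)ᶜ) {x₀ : ℂ}
    (hx₀ : x₀ ∈ D) {σ : ℝ} (hσ0 : 0 < σ) (hσ1 : σ < 1) :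
    ∃ f, DiscMap D x₀ f ∧ ball 0 (σ ^ 2) ⊆ f '' D := by
  obtain ⟨f₀, hf₀, hd₀⟩ := exists_discMap_deriv_ne_zero hD hDc h0 hc hx₀
  set S : Set ℝ := {r | ∃ f, DiscMap D x₀ f ∧ r = ‖deriv f x₀‖} with hS
  obtain ⟨R, hR, hb⟩ := Metric.isOpen_iff.1 hD x₀ hx₀
  have hbdd : BddAbove S := by
    refine ⟨1 / R, ?_⟩
    rintro _ ⟨f, hf, rfl⟩
    refine Complex.norm_deriv_le_div_of_mapsTo_ball (hf.diff.mono hb) (fun x hx => ?_) hR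
    rw [hf.zero, mem_closedBall_zero_iff]
    exact (hf.norm_lt x (hb hx)).le
  have hpos : 0 < sSup S := (norm_pos_iff.2 hd₀).trans_le (le_csSup hbdd ⟨f₀, hf₀, rfl⟩)
  set k := (1 + σ ^ 2) / (2 * σ) with hk
  have hk1 : 1 < k := by
    rw [hk, one_lt_div (by positivity)]
    nlinarith [pow_pos (sub_pos.2 hσ1) 2]
  have hk0 : 0 < k := one_pos.trans hk1
  obtain ⟨_, ⟨f, hf, rfl⟩, hlt⟩ := exists_lt_of_lt_csSup (s := S) ⟨_, f₀, hf₀, rfl⟩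
    (show sSup S / k < sSup S from div_lt_self hpos hk1)
  refine ⟨f, hf, fun a ha => ?_⟩
  by_contra haf
  obtain ⟨g, hg, hge⟩ := hf.exists_norm_deriv_ge hD hDc hx₀ hσ1 hσ0 (mem_ball_zero_iff.1 ha) haf
  rw [div_lt_iff₀ hk0] at hlt
  exact absurd (le_csSup hbdd ⟨g, hg, rfl⟩) (not_le.2 (hlt.trans_le hge))

theorem isSimplyConnected_of_isPreconnected_compl {D : Set ℂ} (hD : IsOpen D)
    (hDc : IsConnected D) (h0 : (0 : ℂ) ∉ D)
    (hc : IsPreconnected (((↑) : ℂ → OnePoint ℂ) '' D)ᶜ) : IsSimplyConnected D := by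
  have : PathConnectedSpace D :=
    isPathConnected_iff_pathConnectedSpace.1 (hD.isConnected_iff_isPathConnected.1 hDc)
  obtain ⟨x₀, hx₀⟩ := hDc.nonempty
  refine simplyConnectedSpace_of_forall_isCompact fun L hL => ?_
  obtain ⟨ρ, hρ, hle⟩ := exists_forall_norm_le hD hDc.isPreconnected hx₀
    (hL.image continuous_subtype_val) (by rintro _ ⟨x, -, rfl⟩; exact x.2)
  obtain ⟨σ, ⟨hσ0, hσρ⟩, hσ1⟩ : ∃ σ : ℝ, (0 < σ ∧ ρ < σ ^ 2) ∧ σ < 1 := by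
    have hm : √(max ρ 0) < 1 := by
      rw [Real.sqrt_lt' one_pos]
      exact max_lt (by linarith) (by norm_num)
    obtain ⟨σ, h1, h2⟩ := exists_between hm
    have h3 : 0 < σ := (Real.sqrt_nonneg _).trans_lt h1
    exact ⟨σ, ⟨h3, (le_max_left _ _).trans_lt ((Real.sqrt_lt' h3).1 h1)⟩, h2⟩
  obtain ⟨f, hf, hball⟩ := exists_discMap_ball_subset hD hDc h0 hc hx₀ hσ0 hσ1
  have hcont : Continuous (D.domRestrict f) :=
    continuousOn_iff_continuous_domRestrict.1 hf.diff.continuousOn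
  have hemb : IsOpenEmbedding (D.domRestrict f) := by
    refine .of_continuous_injective_isOpenMap hcont (injOn_iff_injective.1 hf.inj) fun s hs => ?_
    have : D.domRestrict f '' s = f '' (Subtype.val '' s) := by rw [image_image]; rfl
    rw [this]
    exact isOpen_image_of_injOn hD hDc hf.diff hf.inj (by rintro _ ⟨x, -, rfl⟩; exact x.2)
      (hD.isOpenMap_subtype_val s hs)
  refine ⟨D.domRestrict f ⁻¹' ball 0 (σ ^ 2), fun x hx => ?_, ?_⟩
  · rw [mem_preimage, mem_ball_zero_iff]
    exact (hle f hf.diff hf.norm_lt hf.zero x ⟨x, hx, rfl⟩).trans_lt hσρ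
  · rw [← hemb.isEmbedding.isSimplyConnected_image, image_preimage_eq_of_subset (by
      rw [range_domRestrict]; exact hball)]
    have := (convex_ball (0 : ℂ) (σ ^ 2)).contractibleSpace ⟨0, mem_ball_self (by positivity)⟩
    exact (inferInstance : SimplyConnectedSpace (ball (0 : ℂ) (σ ^ 2)))

theorem OnePoint.exists_homeomorph_infty_zero {z w : OnePoint ℂ} (h : z ≠ w) :
    ∃ e : OnePoint ℂ ≃ₜ OnePoint ℂ, e z = ∞ ∧ e w = ((0 : ℂ) : OnePoint ℂ) := by
  obtain ⟨e, he⟩ : ∃ e : OnePoint ℂ ≃ₜ OnePoint ℂ, e z = ∞ := by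
    induction z using OnePoint.rec with
    | infty => exact ⟨Homeomorph.refl _, rfl⟩
    | coe a =>
      refine ⟨(affineHomeo 1 (-a) one_ne_zero).trans invHomeo, ?_⟩
      rw [Homeomorph.trans_apply, affineHomeo_coe, one_mul, add_neg_cancel]
      exact invFun_zero
  obtain ⟨b, hb⟩ := ne_infty_iff_exists.1 (show e w ≠ ∞ from he ▸ e.injective.ne h.symm)
  refine ⟨e.trans (affineHomeo 1 (-b) one_ne_zero), ?_, ?_⟩
  · rw [Homeomorph.trans_apply, he, affineHomeo_infty]
  · rw [Homeomorph.trans_apply, ← hb, affineHomeo_coe, one_mul, add_neg_cancel]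

theorem Topology.IsEmbedding.image_connectedComponentIn {X Y : Type*} [TopologicalSpace X]
    [TopologicalSpace Y] {f : X → Y} (hf : IsEmbedding f) {W : Set X} {x : X} (hx : x ∈ W) :
    f '' connectedComponentIn W x = connectedComponentIn (f '' W) (f x) := by
  apply subset_antisymm
  · exact (isPreconnected_connectedComponentIn.image f
      hf.continuous.continuousOn).subset_connectedComponentIn
      (mem_image_of_mem f (mem_connectedComponentIn hx))
      (image_mono (connectedComponentIn_subset W x))
  · have hs : f '' (f ⁻¹' connectedComponentIn (f '' W) (f x)) =
        connectedComponentIn (f '' W) (f x) :=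
      image_preimage_eq_of_subset
        ((connectedComponentIn_subset _ _).trans (image_subset_range f W))
    rw [← hs]
    refine image_mono (IsPreconnected.subset_connectedComponentIn ?_
      (mem_connectedComponentIn (mem_image_of_mem f hx)) ?_)
    · rw [← hf.isInducing.isPreconnected_image, hs]
      exact isPreconnected_connectedComponentIn
    · exact fun t ht => hf.injective.mem_set_image.1 (connectedComponentIn_subset _ _ ht)

theorem isPreconnected_compl_connectedComponentIn {X : Type*} [TopologicalSpace X]
    [PreconnectedSpace X] {K : Set X} (hK : IsPreconnected K) (hne : K.Nonempty)
    (ho : ∀ y ∈ Kᶜ, IsOpen (connectedComponentIn Kᶜ y)) (x : X) :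
    IsPreconnected (connectedComponentIn Kᶜ x)ᶜ := by
  have h : (connectedComponentIn Kᶜ x)ᶜ =
      ⋃ y : ↥(connectedComponentIn Kᶜ x)ᶜ, (connectedComponentIn Kᶜ y ∪ K) := by
    ext t
    rw [mem_iUnion]
    constructor
    · intro ht
      refine ⟨⟨t, ht⟩, ?_⟩
      by_cases htK : t ∈ K
      · exact Or.inr htK
      · exact Or.inl (mem_connectedComponentIn htK)
    · rintro ⟨⟨y, hy⟩, ht | ht⟩ htx
      · have hyK : y ∈ Kᶜ := by
          by_contra h
          rw [connectedComponentIn_eq_empty h] at ht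
          exact ht
        rw [mem_compl_iff, connectedComponentIn_eq htx, ← connectedComponentIn_eq ht] at hy
        exact hy (mem_connectedComponentIn hyK)
      · exact connectedComponentIn_subset _ _ htx ht
  obtain ⟨k, hk⟩ := hne
  rw [h]
  refine isPreconnected_iUnion ⟨k, mem_iInter.2 fun y => Or.inr hk⟩ ?_
  rintro ⟨y, hy⟩
  by_cases hyK : y ∈ K
  · rw [connectedComponentIn_eq_empty (not_not.2 hyK), empty_union]
    exact hK
  obtain ⟨p, hp, hpN⟩ := (ho y hyK).exists_mem_closure_notMem ⟨y, mem_connectedComponentIn hyK⟩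
    fun hu => connectedComponentIn_subset Kᶜ y (hu ▸ mem_univ k) hk
  refine isPreconnected_connectedComponentIn.union_of_closure hK ⟨p, hp, ?_⟩
  by_contra hpK
  refine hpN ?_
  have hins : IsPreconnected (insert p (connectedComponentIn Kᶜ y)) :=
    isPreconnected_connectedComponentIn.subset_closure (subset_insert _ _)
      (insert_subset hp subset_closure)
  exact hins.subset_connectedComponentIn (Or.inr (mem_connectedComponentIn hyK))
    (insert_subset hpK (connectedComponentIn_subset _ _)) (mem_insert _ _)

end

theorem separation_two_points
    (C₁ C₂ : Set RSphere) (z w : RSphere) (hzw : z ≠ w)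
    (h₁ : IsContinuum C₁) (h₂ : IsContinuum C₂)
    (hn₁ : NonSeparating C₁) (hn₂ : NonSeparating C₂)
    (hinter : C₁ ∩ C₂ = {z, w}) :
    {D : Set RSphere | ∃ x ∈ (C₁ ∪ C₂)ᶜ, D = connectedComponentIn (C₁ ∪ C₂)ᶜ x}.ncard = 2 ∧
      ∀ x ∈ (C₁ ∪ C₂)ᶜ,
        IsOpen (connectedComponentIn (C₁ ∪ C₂)ᶜ x) ∧
        SimplyConnectedSpace (connectedComponentIn (C₁ ∪ C₂)ᶜ x) := by
  obtain ⟨e, hez, hew⟩ := OnePoint.exists_homeomorph_infty_zero hzw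
  set ι : ℂ → RSphere := fun x => e.symm (x : OnePoint ℂ) with hι
  have hemb : Topology.IsOpenEmbedding ι :=
    e.symm.isOpenEmbedding.comp OnePoint.isOpenEmbedding_coe
  have heι : ∀ x : ℂ, e (ι x) = (x : OnePoint ℂ) := fun x => e.apply_symm_apply _
  have hιz : ∀ x, ι x ≠ z := fun x h => OnePoint.coe_ne_infty x (by rw [← heι, h, hez])
  have hιw : ∀ x, ι x = w ↔ x = 0 := fun x => by
    rw [← e.injective.eq_iff, heι, hew, OnePoint.coe_eq_coe]
  have hrange : ∀ p, p ≠ z → ∃ x, ι x = p := fun p hp => by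
    obtain ⟨x, hx⟩ := OnePoint.ne_infty_iff_exists.1 (hez ▸ e.injective.ne hp)
    exact ⟨x, e.injective (by rw [heι, hx])⟩
  have hz : z ∈ C₁ ∩ C₂ := hinter ▸ mem_insert z {w}
  have hw : w ∈ C₁ ∩ C₂ := hinter ▸ mem_insert_of_mem z rfl
  have hU : ∀ C : Set RSphere, IsContinuum C → NonSeparating C → z ∈ C → w ∈ C →
      IsOpen (ι ⁻¹' Cᶜ) ∧ IsPreconnected (ι ⁻¹' Cᶜ) ∧ HasLogSub (ι ⁻¹' Cᶜ) 0 := by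
    intro C hC hn hzC hwC
    have ho : IsOpen (ι ⁻¹' Cᶜ) := hC.2.1.isClosed.isOpen_compl.preimage hemb.continuous
    have him : ι '' (ι ⁻¹' Cᶜ) = Cᶜ :=
      image_preimage_eq_of_subset fun p hp => hrange p fun h => hp (h ▸ hzC)
    have hc : IsPreconnected (ι ⁻¹' Cᶜ) := by
      rw [← hemb.isInducing.isPreconnected_image, him]
      exact hn.2.isPreconnected
    have hne : (ι ⁻¹' Cᶜ).Nonempty := by
      rw [← image_nonempty (f := ι), him]
      exact hn.1
    refine ⟨ho, hc, hasLogSub_of_isPreconnected ho ⟨hne, hc⟩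
      (hC.2.2.isPreconnected.image e e.continuous.continuousOn) ⟨z, hzC, hez⟩ ⟨w, hwC, hew⟩ ?_⟩
    rintro x hx ⟨p, hp, hpx⟩
    refine hx ?_
    rwa [e.injective ((heι x).trans hpx.symm)]
  obtain ⟨o₁, c₁, l₁⟩ := hU C₁ h₁ hn₁ hz.1 hw.1
  obtain ⟨o₂, c₂, l₂⟩ := hU C₂ h₂ hn₂ hz.2 hw.2
  set W : Set ℂ := ι ⁻¹' C₁ᶜ ∩ ι ⁻¹' C₂ᶜ with hW
  have hV : (C₁ ∪ C₂)ᶜ = ι '' W := by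
    rw [hW, ← preimage_inter, ← compl_union, image_preimage_eq_of_subset]
    exact fun p hp => hrange p fun h => hp (h ▸ Or.inl hz.1)
  have hunion : ι ⁻¹' C₁ᶜ ∪ ι ⁻¹' C₂ᶜ = {0}ᶜ := by
    rw [← preimage_union, ← compl_inter, hinter]
    ext x
    simp [hιz, hιw]
  have hcomp : ∀ x ∈ W, connectedComponentIn (C₁ ∪ C₂)ᶜ (ι x) = ι '' connectedComponentIn W x :=
    fun x hx => by rw [hV, hemb.isEmbedding.image_connectedComponentIn hx]
  have hopen : ∀ x ∈ (C₁ ∪ C₂)ᶜ, IsOpen (connectedComponentIn (C₁ ∪ C₂)ᶜ x) := by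
    intro p hp
    obtain ⟨x, hx, rfl⟩ := hV.subset hp
    rw [hcomp x hx]
    exact hemb.isOpenMap _ (o₁.inter o₂).connectedComponentIn
  refine ⟨?_, fun p hp => ⟨hopen p hp, ?_⟩⟩
  · have himg : {D : Set RSphere | ∃ x ∈ (C₁ ∪ C₂)ᶜ, D = connectedComponentIn (C₁ ∪ C₂)ᶜ x} =
        image ι '' {D | ∃ x ∈ W, D = connectedComponentIn W x} := by
      ext D
      constructor
      · rintro ⟨p, hp, rfl⟩
        obtain ⟨x, hx, rfl⟩ := hV.subset hp
        exact ⟨_, ⟨x, hx, rfl⟩, (hcomp x hx).symm⟩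
      · rintro ⟨_, ⟨x, hx, rfl⟩, rfl⟩
        exact ⟨ι x, hV ▸ mem_image_of_mem ι hx, (hcomp x hx).symm⟩
    rw [himg, ncard_image_of_injective _ hemb.injective.image_injective]
    exact ncard_components_inter_eq_two o₁ o₂ c₁ c₂ hunion l₁ l₂
  · have hpre := isPreconnected_compl_connectedComponentIn (h₁.2.2.isPreconnected.union z hz.1 hz.2
      h₂.2.2.isPreconnected) ⟨z, Or.inl hz.1⟩ hopen p
    obtain ⟨x, hx, rfl⟩ := hV.subset hp
    rw [hcomp x hx] at hpre ⊢
    refine (hemb.isEmbedding.isSimplyConnected_image (s := connectedComponentIn W x)).2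
      (isSimplyConnected_of_isPreconnected_compl (o₁.inter o₂).connectedComponentIn
        (isConnected_connectedComponentIn_iff.2 hx) (fun h => ?_) ?_)
    · exact (connectedComponentIn_subset W x h).1 ((hιw 0).2 rfl ▸ hw.1)
    · have := hpre.image e e.continuous.continuousOn
      rw [image_compl_eq e.bijective, image_image] at this
      simpa only [heι] using this
end
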